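/- arXiv:2207.08764 — 6 statements merged into one kernel-verified Lean document; each statement's English description precedes it below -/
import Mathlib

section
/- Let E and Ẽ be finite sets, π : Ẽ → E a surjection, and f a polymatroid rank function on E. Define g : 2^Ẽ → ℕ by g(S) = min over A ⊆ E of ( f(A) + |S ∖ π⁻¹(A)| ). Then g is a matroid rank function on Ẽ: g(∅) = 0; g(S) ≤ g(T) whenever S ⊆ T; g(S ∪ T) + g(S ∩ T) ≤ g(S) + g(T) for all S, T ⊆ Ẽ; and g(S) ≤ |S| for every S ⊆ Ẽ. -/
/-- The lifted rank function of a polymatroid rank function `f` along a map `π`: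
`g(S) = min over A ⊆ E of (f(A) + |S \ π⁻¹(A)|)`. -/
def liftRank {Et E : Type*} [Fintype Et] [Fintype E] [DecidableEq E] [DecidableEq Et]
    (π : Et → E) (f : Finset E → ℕ) (S : Finset Et) : ℕ :=
  Finset.univ.inf' Finset.univ_nonempty
    (fun A : Finset E => f A + (S.filter (fun x => π x ∉ A)).card)

theorem liftRank_le {Et E : Type*} [Fintype Et] [Fintype E] [DecidableEq E] [DecidableEq Et]
    (π : Et → E) (f : Finset E → ℕ) (S : Finset Et) (A : Finset E) :
    liftRank π f S ≤ f A + (S.filter (fun x => π x ∉ A)).card :=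
  Finset.inf'_le _ (Finset.mem_univ A)

theorem exists_liftRank_eq {Et E : Type*} [Fintype Et] [Fintype E] [DecidableEq E]
    [DecidableEq Et] (π : Et → E) (f : Finset E → ℕ) (S : Finset Et) :
    ∃ A : Finset E, liftRank π f S = f A + (S.filter (fun x => π x ∉ A)).card := by
  obtain ⟨A, -, hA⟩ := Finset.exists_mem_eq_inf' Finset.univ_nonempty
    (fun A : Finset E => f A + (S.filter (fun x => π x ∉ A)).card)
  exact ⟨A, hA⟩

theorem card_filter_union_add_card_filter_inter_le {Et E : Type*} [DecidableEq E]
    [DecidableEq Et] (π : Et → E) (S T : Finset Et) (A B : Finset E) :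
    ((S ∪ T).filter (fun x => π x ∉ A ∪ B)).card + ((S ∩ T).filter (fun x => π x ∉ A ∩ B)).card ≤
      (S.filter (fun x => π x ∉ A)).card + (T.filter (fun x => π x ∉ B)).card := by
  rw [← Finset.card_union_add_card_inter (S.filter (fun x => π x ∉ A)),
    ← Finset.card_union_add_card_inter ((S ∪ T).filter (fun x => π x ∉ A ∪ B))]
  refine Nat.add_le_add (Finset.card_le_card ?_) (Finset.card_le_card ?_) <;>
  · intro x
    simp only [Finset.mem_union, Finset.mem_inter, Finset.mem_filter]
    tauto

/-- the lifted rank function of a polymatroid rank function is a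
matroid rank function: normalized, monotone, submodular, and bounded by cardinality. -/
theorem lift_is_matroid_rank {Et E : Type*} [Fintype Et] [Fintype E]
    [DecidableEq E] [DecidableEq Et]
    (π : Et → E) (hπ : Function.Surjective π) (f : Finset E → ℕ)
    (hsub : ∀ A B : Finset E, f (A ∪ B) + f (A ∩ B) ≤ f A + f B)
    (hmono : ∀ A B : Finset E, A ⊆ B → f A ≤ f B)
    (hnorm : f ∅ = 0) :
    liftRank π f ∅ = 0 ∧
    (∀ S T : Finset Et, S ⊆ T → liftRank π f S ≤ liftRank π f T) ∧
    (∀ S T : Finset Et,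
      liftRank π f (S ∪ T) + liftRank π f (S ∩ T) ≤ liftRank π f S + liftRank π f T) ∧
    (∀ S : Finset Et, liftRank π f S ≤ S.card) := by
  refine ⟨?_, fun S T hST => ?_, fun S T => ?_, fun S => ?_⟩
  · simpa [hnorm] using liftRank_le π f ∅ ∅
  · obtain ⟨A, hA⟩ := exists_liftRank_eq π f T
    rw [hA]
    exact (liftRank_le π f S A).trans
      (Nat.add_le_add_left (Finset.card_le_card (Finset.filter_subset_filter _ hST)) _)
  · obtain ⟨A, hA⟩ := exists_liftRank_eq π f S
    obtain ⟨B, hB⟩ := exists_liftRank_eq π f T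
    have h_union := liftRank_le π f (S ∪ T) (A ∪ B)
    have h_inter := liftRank_le π f (S ∩ T) (A ∩ B)
    have h_card := card_filter_union_add_card_filter_inter_le π S T A B
    have h_sub := hsub A B
    omega
  · simpa [hnorm] using liftRank_le π f S ∅
end

section
/- Let E and Ẽ be finite sets, π : Ẽ → E a surjection, and f a polymatroid rank function on E satisfying |π⁻¹(i)| = f({i}) for every i ∈ E. Let g be the lifted rank function. If S ⊆ Ẽ is a union of fibers of π (i.e. S = π⁻¹(π(S))), then g(S) = f(π(S)). -/
/-- A submodular function grows by at most the sum of its values on the added singletons. -/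
theorem submodular_union_le_add_sum {E : Type*} [DecidableEq E] (f : Finset E → ℕ)
    (hsub : ∀ A B : Finset E, f (A ∪ B) + f (A ∩ B) ≤ f A + f B) (A T : Finset E) :
    f (A ∪ T) ≤ f A + ∑ i ∈ T, f {i} := by
  induction T using Finset.induction_on with
  | empty => simp
  | insert i T hi ih =>
    have h := hsub (A ∪ T) {i}
    have e : A ∪ insert i T = (A ∪ T) ∪ {i} := by ext; simp
    rw [e, Finset.sum_insert hi]
    omega

/-- if `|π⁻¹(i)| = f({i})` for every `i` and `S` is a union of fibers of `π`,
then the lifted rank of `S` equals `f(π(S))`. -/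
theorem liftRank_of_saturated {Et E : Type*} [Fintype Et] [Fintype E]
    [DecidableEq E] [DecidableEq Et]
    (π : Et → E) (hπ : Function.Surjective π) (f : Finset E → ℕ)
    (hsub : ∀ A B : Finset E, f (A ∪ B) + f (A ∩ B) ≤ f A + f B)
    (hmono : ∀ A B : Finset E, A ⊆ B → f A ≤ f B)
    (hnorm : f ∅ = 0)
    (hfiber : ∀ i : E, (Finset.univ.filter (fun x => π x = i)).card = f {i})
    (S : Finset Et)
    (hS : S = Finset.univ.filter (fun x => π x ∈ S.image π)) :
    liftRank π f S = f (S.image π) := by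
  apply le_antisymm
  · refine (Finset.inf'_le _ (Finset.mem_univ (S.image π))).trans ?_
    have h : S.filter (fun x => π x ∉ S.image π) = ∅ :=
      Finset.filter_eq_empty_iff.2 fun x hx h => h (Finset.mem_image_of_mem π hx)
    simp only [h, Finset.card_empty, add_zero, le_refl]
  · refine Finset.le_inf' _ _ fun A _ => ?_
    have hcard : (S.filter (fun x => π x ∉ A)).card = ∑ i ∈ S.image π \ A, f {i} := by
      rw [Finset.card_eq_sum_card_fiberwise (f := π) (t := S.image π \ A)]
      · refine Finset.sum_congr rfl fun i hi => ?_
        rw [← hfiber i]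
        congr 1
        ext x
        have hx : x ∈ S ↔ π x ∈ S.image π := by
          conv_lhs => rw [hS]
          simp only [Finset.mem_filter, Finset.mem_univ, true_and]
        rw [Finset.mem_sdiff] at hi
        simp only [Finset.mem_filter, Finset.mem_univ, true_and, hx]
        exact ⟨fun h => h.2, by rintro rfl; exact ⟨hi, rfl⟩⟩
      · intro x hx
        have hx' := Finset.mem_filter.1 hx
        exact Finset.mem_sdiff.2 ⟨Finset.mem_image_of_mem π hx'.1, hx'.2⟩
    rw [hcard]
    refine (hmono _ (A ∪ (S.image π \ A)) ?_).trans (submodular_union_le_add_sum f hsub A _)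
    rw [Finset.union_sdiff_self_eq_union]
    exact Finset.subset_union_right
end

section
/- Let E and Ẽ be finite sets, π : Ẽ → E a surjection, and f a polymatroid rank function on E. Let F be a flat of f (meaning f(F∪{i}) > f(F) for all i ∈ E∖F). Then for every S ⊆ π⁻¹(F), min over A ⊆ F of ( f(A) + |S ∖ π⁻¹(A)| ) = min over A ⊆ E of ( f(A) + |S ∖ π⁻¹(A)| ). (Equivalently: the minimal multisymmetric lift of the restriction of a polymatroid to a flat F equals the restriction of its minimal multisymmetric lift to π⁻¹(F).) -/
/-- for a flat `F` of a polymatroid `f` and any `S ⊆ π⁻¹(F)`, the minimum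
defining the lifted rank of `S` may be taken over subsets of `F` only:
the lift of the restriction `f|_F` equals the restriction of the lift. -/
theorem liftRank_restriction_to_flat {Et E : Type*} [Fintype Et] [Fintype E]
    [DecidableEq E] [DecidableEq Et]
    (π : Et → E) (hπ : Function.Surjective π) (f : Finset E → ℕ)
    (hsub : ∀ A B : Finset E, f (A ∪ B) + f (A ∩ B) ≤ f A + f B)
    (hmono : ∀ A B : Finset E, A ⊆ B → f A ≤ f B)
    (hnorm : f ∅ = 0)
    (F : Finset E) (hflat : ∀ i ∉ F, f F < f (insert i F))
    (S : Finset Et) (hS : ∀ x ∈ S, π x ∈ F) :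
    F.powerset.inf' (F.powerset_nonempty)
        (fun A : Finset E => f A + (S.filter (fun x => π x ∉ A)).card)
      = Finset.univ.inf' Finset.univ_nonempty
        (fun A : Finset E => f A + (S.filter (fun x => π x ∉ A)).card) := by
  refine le_antisymm (Finset.le_inf' _ _ fun A _ => ?_)
    (Finset.inf'_mono _ (Finset.subset_univ _) _)
  refine (Finset.inf'_le _ (Finset.mem_powerset.2 (Finset.inter_subset_right (s₁ := A)))).trans ?_
  have hfilter : S.filter (fun x => π x ∉ A ∩ F) = S.filter (fun x => π x ∉ A) :=
    Finset.filter_congr fun x hx => by simp [hS x hx]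
  rw [hfilter]
  exact Nat.add_le_add_right (hmono _ _ Finset.inter_subset_left) _
end

section
/- Let f be a loopless polymatroid rank function on a finite nonempty set E, let Ẽ be a finite set and π : Ẽ → E a surjection with |π⁻¹(i)| = f({i}) for every i ∈ E. Let DP(f) be the quotient of the polynomial ring ℤ[x_F : F a nonempty flat of f] by the ideal generated by all elements (∏_{G'∈𝒮} x_{G'})·(∑_{flats H with H ⊇ G} x_H)^b, where G ranges over nonempty flats of f, 𝒮 over finite collections of nonempty flats of f, and b over natural numbers with b ≥ f(G) − f(⋃{G' ∈ 𝒮 : G' ⊊ G}). Let A(Σ_f) be the quotient of the polynomial ring ℤ[z_F : F a nonempty proper flat of f][z_t : t ∈ Ẽ] by the ideal generated by: (i) z_{F₁}·z_{F₂} for all incomparable nonempty proper flats F₁, F₂ of f; (ii) z_F·∏_{t∈T} z_t for every proper flat F of f (with the factor z_∅ interpreted as 1 when F = ∅) and every nonempty T ⊆ Ẽ ∖ π⁻¹(F) with f(F ∪ π(T)) ≤ f(F) + |T|; (iii) (z_s + ∑_{nonempty proper flats F with π(s) ∈ F} z_F) − (z_t + ∑_{nonempty proper flats G with π(t) ∈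 G} z_G) for all s, t ∈ Ẽ. Then there is a ring isomorphism φ : DP(f) → A(Σ_f) with φ(x_F) = z_F for every nonempty proper flat F of f, and φ(x_E) = −(z_s + ∑_{nonempty proper flats F with π(s) ∈ F} z_F) for every s ∈ Ẽ. -/
open scoped Classical

noncomputable section

/-- A flat of a polymatroid rank function `f`: a set whose rank strictly increases
upon adding any new element. -/
def IsFlat {E : Type*} (f : Finset E → ℕ) (F : Finset E) : Prop :=
  ∀ i ∉ F, f F < f (insert i F)

/-- Variables of the Pagaria–Pezzoli Chow ring: nonempty flats. -/
def FlatVar {E : Type*} (f : Finset E → ℕ) : Type _ :=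
  {F : Finset E // IsFlat f F ∧ F.Nonempty}

instance {E : Type*} [Fintype E] (f : Finset E → ℕ) : Fintype (FlatVar f) :=
  Subtype.fintype _

/-- Defining relations of the Pagaria–Pezzoli Chow ring `DP(f)` (maximal building set):
`(∏_{G'∈𝒮} x_{G'})·(∑_{H ⊇ G} x_H)^b` for `G` a nonempty flat, `𝒮` a finite collection of
nonempty flats, and `b ≥ f(G) − f(⋃{G' ∈ 𝒮 : G' ⊊ G})`. -/
def DPrels {E : Type*} [Fintype E] (f : Finset E → ℕ) :
    Set (MvPolynomial (FlatVar f) ℤ) :=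
  { p | ∃ (G : FlatVar f) (S : Finset (FlatVar f)) (b : ℕ),
      f G.1 - f ((S.filter (fun G' => G'.1 ⊂ G.1)).sup (fun G' => G'.1)) ≤ b ∧
      p = (∏ G' ∈ S, MvPolynomial.X G') *
          (∑ H ∈ Finset.univ.filter (fun H : FlatVar f => G.1 ⊆ H.1),
            MvPolynomial.X H) ^ b }

/-- Variables of the Chow ring of the Bergman fan: nonempty proper flats. -/
def PFlatVar {E : Type*} [Fintype E] (f : Finset E → ℕ) : Type _ :=
  {F : Finset E // IsFlat f F ∧ F.Nonempty ∧ F ≠ Finset.univ}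

instance {E : Type*} [Fintype E] (f : Finset E → ℕ) : Fintype (PFlatVar f) :=
  Subtype.fintype _

/-- `z_F` for a proper flat `F`, with `z_∅` interpreted as `1`. -/
def zFlat {E : Type*} [Fintype E] (f : Finset E → ℕ) (Et : Type*) (F : Finset E) :
    MvPolynomial (PFlatVar f ⊕ Et) ℤ :=
  if h : IsFlat f F ∧ F.Nonempty ∧ F ≠ Finset.univ then MvPolynomial.X (Sum.inl ⟨F, h⟩)
  else 1

/-- The linear form `z_s + ∑_{F ∋ π(s)} z_F` attached to `s ∈ Ẽ`. -/
def linForm {E Et : Type*} [Fintype E] (π : Et → E) (f : Finset E → ℕ) (s : Et) :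
    MvPolynomial (PFlatVar f ⊕ Et) ℤ :=
  MvPolynomial.X (Sum.inr s) +
    ∑ F ∈ Finset.univ.filter (fun F : PFlatVar f => π s ∈ F.1),
      MvPolynomial.X (Sum.inl F)

/-- Defining relations of the Chow ring `A(Σ_f)` of the Bergman fan of `f`. -/
def Arels {E Et : Type*} [Fintype E] [Fintype Et] (π : Et → E) (f : Finset E → ℕ) :
    Set (MvPolynomial (PFlatVar f ⊕ Et) ℤ) :=
  { p |
    (∃ F₁ F₂ : PFlatVar f, ¬ F₁.1 ⊆ F₂.1 ∧ ¬ F₂.1 ⊆ F₁.1 ∧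
        p = MvPolynomial.X (Sum.inl F₁) * MvPolynomial.X (Sum.inl F₂)) ∨
    (∃ (F : Finset E) (T : Finset Et), IsFlat f F ∧ F ≠ Finset.univ ∧
        T.Nonempty ∧ (∀ t ∈ T, π t ∉ F) ∧ f (F ∪ T.image π) ≤ f F + T.card ∧
        p = zFlat f Et F * ∏ t ∈ T, MvPolynomial.X (Sum.inr t)) ∨
    (∃ s t : Et, p = linForm π f s - linForm π f t) }

section Combinatorics

variable {E Et : Type*} {f : Finset E → ℕ}

/-- The marginal rank of an element decreases along inclusions. -/
lemma rank_insert_add_le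
    (hsub : ∀ A B : Finset E, f (A ∪ B) + f (A ∩ B) ≤ f A + f B)
    {A B : Finset E} (hAB : A ⊆ B) {i : E} (hi : i ∉ B) :
    f (insert i B) + f A ≤ f (insert i A) + f B := by
  have h := hsub (insert i A) B
  have h1 : insert i A ∪ B = insert i B := by grind
  have h2 : insert i A ∩ B = A := by grind
  rwa [h1, h2] at h

/-- Every set is contained in a smallest flat, and that flat has the same rank. -/
lemma exists_closure [Fintype E]
    (hsub : ∀ A B : Finset E, f (A ∪ B) + f (A ∩ B) ≤ f A + f B)
    (hmono : ∀ A B : Finset E, A ⊆ B → f A ≤ f B) (A : Finset E) :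
    ∃ C, IsFlat f C ∧ A ⊆ C ∧ f C = f A ∧ ∀ K, IsFlat f K → A ⊆ K → C ⊆ K := by
  set C := Finset.univ.filter (fun i => f (insert i A) = f A) with hC
  have hAC : A ⊆ C := fun i hi => by simp [hC, Finset.insert_eq_of_mem hi]
  have key : ∀ B : Finset E, B ⊆ C → f (A ∪ B) = f A := by
    intro B
    induction B using Finset.induction_on with
    | empty => simp
    | insert i B hi ih =>
      intro hB
      have hB' := ih ((Finset.subset_insert i B).trans hB)
      have hiC : f (insert i A) = f A := by
        simpa [hC] using hB (Finset.mem_insert_self i B)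
      by_cases h : i ∈ A ∪ B
      · rw [Finset.union_insert, Finset.insert_eq_of_mem h, hB']
      · have h1 := rank_insert_add_le hsub (Finset.subset_union_left (s₁ := A) (s₂ := B)) h
        have h2 := hmono A (insert i (A ∪ B)) (by grind)
        rw [Finset.union_insert]
        omega
  have hfC : f C = f A := by
    have h := key C subset_rfl
    rwa [Finset.union_eq_right.2 hAC] at h
  refine ⟨C, fun i hi => ?_, hAC, hfC, fun K hK hAK i hi => ?_⟩
  · have h1 : f (insert i A) ≠ f A := by simpa [hC] using hi
    have h2 := hmono A (insert i A) (Finset.subset_insert i A)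
    have h3 := hmono (insert i A) (insert i C) (Finset.insert_subset_insert i hAC)
    omega
  · by_contra hiK
    have h1 := hK i hiK
    have h2 := rank_insert_add_le hsub hAK hiK
    have h3 : f (insert i A) = f A := by simpa [hC] using hi
    omega

/-- A basis of `G` relative to `H` in the lift of `f` to `Et`. -/
lemma exists_relative_basis [Fintype Et] (π : Et → E)
    (hsub : ∀ A B : Finset E, f (A ∪ B) + f (A ∩ B) ≤ f A + f B)
    (hmono : ∀ A B : Finset E, A ⊆ B → f A ≤ f B) (hnorm : f ∅ = 0)
    (hfiber : ∀ i : E, (Finset.univ.filter (fun x => π x = i)).card = f {i})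
    (H D : Finset E) :
    ∃ T : Finset Et, (∀ t ∈ T, π t ∈ H ∪ D) ∧ f H + T.card = f (H ∪ D) ∧
      ∀ K, H ⊆ K → f (H ∪ D ∪ K) ≤ f K + (T.filter (fun t => π t ∉ K)).card := by
  induction D using Finset.induction_on with
  | empty =>
    exact ⟨∅, by simp, by simp, fun K hK => by simp [Finset.union_eq_right.2 hK]⟩
  | insert i D hi ih =>
    obtain ⟨T, hT, hcard, hK⟩ := ih
    rw [Finset.union_insert]
    by_cases hiG : i ∈ H ∪ D
    · rw [Finset.insert_eq_of_mem hiG]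
      exact ⟨T, hT, hcard, hK⟩
    have h1 : f (insert i (H ∪ D)) - f (H ∪ D) ≤
        (Finset.univ.filter (fun x => π x = i)).card := by
      have h := rank_insert_add_le hsub (Finset.empty_subset (H ∪ D)) hiG
      rw [hfiber, ← insert_empty_eq]
      omega
    obtain ⟨T', hT', hcard'⟩ := Finset.exists_subset_card_eq h1
    have hT'i : ∀ t ∈ T', π t = i := fun t ht => by simpa using hT' ht
    have hdisj : Disjoint T T' := Finset.disjoint_left.2 fun t h h' =>
      hiG (hT'i t h' ▸ hT t h)
    have h2 := hmono (H ∪ D) (insert i (H ∪ D)) (Finset.subset_insert _ _)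
    refine ⟨T ∪ T', fun t ht => ?_, ?_, fun K hHK => ?_⟩
    · rcases Finset.mem_union.1 ht with h | h
      · exact Finset.mem_insert_of_mem (hT t h)
      · exact hT'i t h ▸ Finset.mem_insert_self _ _
    · rw [Finset.card_union_of_disjoint hdisj]
      omega
    · have h3 := hK K hHK
      rw [Finset.insert_union, Finset.filter_union, Finset.card_union_of_disjoint
        (Finset.disjoint_filter_filter hdisj)]
      by_cases hiK : i ∈ H ∪ D ∪ K
      · rw [Finset.insert_eq_of_mem hiK]
        omega
      · have h4 := rank_insert_add_le hsub (Finset.subset_union_left (s₁ := H ∪ D) (s₂ := K)) hiK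
        have h5 : T'.filter (fun t => π t ∉ K) = T' := Finset.filter_true_of_mem fun t ht => by
          rw [hT'i t ht]
          exact fun h => hiK (Finset.mem_union_right _ h)
        rw [h5]
        omega

end Combinatorics

section ChainSupported

variable {E Et R : Type*} [CommRing R] {f : Finset E → ℕ} {x : Finset E → R}

lemma mul_eq_zero_of_mem_span {S : Set R} {a c : R} (ha : a ∈ Ideal.span S)
    (h : ∀ s ∈ S, s * c = 0) : a * c = 0 := by
  induction ha using Submodule.span_induction with
  | mem s hs => exact h s hs
  | zero => exact zero_mul c
  | add a b _ _ ha hb => rw [add_mul, ha, hb, add_zero]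
  | smul r a _ ha => rw [smul_eq_mul, mul_assoc, ha, mul_zero]

lemma mul_prod_neg_eq_zero {ι : Type*} {a : R} {s : Finset ι} {g : ι → R}
    (h : a * ∏ i ∈ s, g i = 0) : a * ∏ i ∈ s, -g i = 0 := by
  rw [Finset.prod_neg, mul_left_comm, h, mul_zero]

/-- Products of `x` at incomparable flats vanish. -/
def ChainSupported (f : Finset E → ℕ) (x : Finset E → R) : Prop :=
  ∀ F₁ F₂, IsFlat f F₁ → IsFlat f F₂ → ¬ F₁ ⊆ F₂ → ¬ F₂ ⊆ F₁ → x F₁ * x F₂ = 0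

/-- A nonvanishing product over a set of nonempty flats is indexed by a chain, so that the
union of a nonempty index set is one of its members. -/
lemma prod_eq_zero_or_sup_mem (hx : ChainSupported f x) (S : Finset (FlatVar f)) :
    ∏ K ∈ S, x K.1 = 0 ∨ S = ∅ ∨ ∃ K ∈ S, S.sup (fun K => K.1) = K.1 := by
  induction S using Finset.induction_on with
  | empty => simp
  | insert K S hK ih =>
    rw [Finset.prod_insert hK, Finset.sup_insert]
    rcases ih with h | rfl | ⟨L, hL, hsup⟩
    · left
      rw [h, mul_zero]
    · right; right
      exact ⟨K, by simp, by simp⟩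
    · rw [hsup]
      by_cases h1 : K.1 ⊆ L.1
      · exact Or.inr (Or.inr ⟨L, Finset.mem_insert_of_mem hL, Finset.union_eq_right.2 h1⟩)
      by_cases h2 : L.1 ⊆ K.1
      · exact Or.inr (Or.inr ⟨K, Finset.mem_insert_self _ _, Finset.union_eq_left.2 h2⟩)
      · left
        rw [← Finset.mul_prod_erase S _ hL, ← mul_assoc, hx K.1 L.1 K.2.1 L.2.1 h1 h2, zero_mul]

variable [Fintype E]

/-- The sum of `x H` over the nonempty flats `H` containing `A`. -/
def flatSum (f : Finset E → ℕ) (x : Finset E → R) (A : Finset E) : R :=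
  ∑ H ∈ Finset.univ.filter (fun H : FlatVar f => A ⊆ H.1), x H.1

/-- The sum of `x H` over the nonempty flats `H` containing `A` but not `G`. -/
def flatSumAvoiding (f : Finset E → ℕ) (x : Finset E → R) (A G : Finset E) : R :=
  ∑ H ∈ Finset.univ.filter (fun H : FlatVar f => A ⊆ H.1 ∧ ¬ G ⊆ H.1), x H.1

lemma flatSum_eq_add_flatSumAvoiding {A G : Finset E} (h : A ⊆ G) :
    flatSum f x A = flatSum f x G + flatSumAvoiding f x A G := by
  unfold flatSum flatSumAvoiding
  rw [← Finset.sum_filter_add_sum_filter_not _ (fun H : FlatVar f => G ⊆ H.1),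
    Finset.filter_filter, Finset.filter_filter]
  congr 2
  ext H
  simp only [Finset.mem_filter, Finset.mem_univ, true_and, and_iff_right_iff_imp]
  exact h.trans

lemma mul_prod_flatSumAvoiding_mem (π : Et → E) (hx : ChainSupported f x) {F G : Finset E}
    (hF : IsFlat f F) (hFG : ¬ G ⊆ F) (T : Finset Et) :
    x F * ∏ t ∈ T, flatSumAvoiding f x {π t} G ∈
      Ideal.span (x '' {H | IsFlat f H ∧ F ∪ T.image π ⊆ H ∧ ¬ G ⊆ H}) := by
  induction T using Finset.induction_on with
  | empty =>
    rw [Finset.prod_empty, mul_one]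
    exact Ideal.subset_span ⟨F, ⟨hF, by simp, hFG⟩, rfl⟩
  | insert t T ht ih =>
    rw [Finset.prod_insert ht, mul_left_comm, mul_comm]
    generalize x F * ∏ t ∈ T, flatSumAvoiding f x {π t} G = a at ih ⊢
    induction ih using Submodule.span_induction with
    | zero => simp
    | add a b _ _ ha hb => rw [add_mul]; exact add_mem ha hb
    | smul r a _ ha => rw [smul_eq_mul, mul_assoc]; exact Ideal.mul_mem_left _ _ ha
    | mem a ha =>
      obtain ⟨H, ⟨hH, hTH, hGH⟩, rfl⟩ := ha
      rw [flatSumAvoiding, Finset.mul_sum]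
      refine sum_mem fun K hK => ?_
      obtain ⟨htK, hGK⟩ : {π t} ⊆ K.1 ∧ ¬ G ⊆ K.1 := by simpa using hK
      rw [Finset.singleton_subset_iff] at htK
      by_cases h1 : K.1 ⊆ H
      · refine Ideal.mul_mem_right _ _ (Ideal.subset_span ⟨H, ⟨hH, ?_, hGH⟩, rfl⟩)
        rw [Finset.image_insert, Finset.union_insert]
        exact Finset.insert_subset (h1 htK) hTH
      by_cases h2 : H ⊆ K.1
      · refine Ideal.mul_mem_left _ _ (Ideal.subset_span ⟨K.1, ⟨K.2.1, ?_, hGK⟩, rfl⟩)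
        rw [Finset.image_insert, Finset.union_insert]
        exact Finset.insert_subset htK (hTH.trans h2)
      · rw [hx H K.1 hH K.2.1 h2 h1]
        exact zero_mem _

lemma mul_flatSum_congr (hx : ChainSupported f x) {H G C : Finset E} (hH : IsFlat f H)
    (hGH : ¬ G ⊆ H) (hC : ∀ K, IsFlat f K → (C ⊆ K ↔ H ∪ G ⊆ K)) :
    x H * flatSum f x G = x H * flatSum f x C := by
  unfold flatSum
  rw [Finset.mul_sum, Finset.mul_sum]
  symm
  refine Finset.sum_subset (fun K hK => ?_) fun K hK hKC => ?_
  · simp only [Finset.mem_filter, Finset.mem_univ, true_and] at hK ⊢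
    exact Finset.union_subset_right ((hC K.1 K.2.1).1 hK)
  · simp only [Finset.mem_filter, Finset.mem_univ, true_and] at hK hKC
    refine hx H K.1 hH K.2.1 (fun h => hKC ?_) fun h => hGH (hK.trans h)
    exact (hC K.1 K.2.1).2 (Finset.union_subset h hK)

lemma mul_flatSum_pow_congr (hx : ChainSupported f x) {H G C : Finset E} (hH : IsFlat f H)
    (hGH : ¬ G ⊆ H) (hC : ∀ K, IsFlat f K → (C ⊆ K ↔ H ∪ G ⊆ K)) (b : ℕ) :
    x H * flatSum f x G ^ b = x H * flatSum f x C ^ b := by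
  induction b with
  | zero => simp
  | succ b ih =>
    rw [pow_succ, ← mul_assoc, ih, mul_right_comm, mul_flatSum_congr hx hH hGH hC, pow_succ]
    ring

/-- The power relations of the Pagaria–Pezzoli ring imply the monomial relations of the
Bergman fan. -/
lemma mul_prod_flatSum_eq_zero (π : Et → E)
    (hsub : ∀ A B : Finset E, f (A ∪ B) + f (A ∩ B) ≤ f A + f B)
    (hmono : ∀ A B : Finset E, A ⊆ B → f A ≤ f B) (hx : ChainSupported f x)
    (hrel : ∀ (H G : Finset E) (b : ℕ), IsFlat f H → IsFlat f G → H ⊂ G → f G - f H ≤ b →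
      x H * flatSum f x G ^ b = 0)
    {F : Finset E} (hF : IsFlat f F) (T : Finset Et) (hT : T.Nonempty)
    (hTF : ∀ t ∈ T, π t ∉ F) (hrank : f (F ∪ T.image π) ≤ f F + T.card) :
    x F * ∏ t ∈ T, flatSum f x {π t} = 0 := by
  induction T using Finset.strongInduction with
  | H T ih =>
  by_cases hmin : ∃ T' ⊂ T, T'.Nonempty ∧ f (F ∪ T'.image π) ≤ f F + T'.card
  · obtain ⟨T', hT', hne, hr⟩ := hmin
    rw [← Finset.prod_sdiff hT'.subset, mul_left_comm,
      ih T' hT' hne (fun t ht => hTF t (hT'.subset ht)) hr, mul_zero]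
  push Not at hmin
  obtain ⟨G, hG, hTG, hfG, hGmin⟩ := exists_closure hsub hmono (F ∪ T.image π)
  have hπG : ∀ t ∈ T, π t ∈ G := fun t ht =>
    hTG (Finset.mem_union_right _ (Finset.mem_image_of_mem π ht))
  have hGF : ¬ G ⊆ F := by
    obtain ⟨t, ht⟩ := hT
    exact fun h => hTF t ht (h (hπG t ht))
  rw [Finset.prod_congr rfl fun t ht => (flatSum_eq_add_flatSumAvoiding (f := f) (x := x)
    (Finset.singleton_subset_iff.2 (hπG t ht))).trans (add_comm _ _), Finset.prod_add,
    Finset.mul_sum]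
  refine Finset.sum_eq_zero fun T₁ hT₁ => ?_
  rw [Finset.mem_powerset] at hT₁
  rw [Finset.prod_const, ← mul_assoc]
  refine mul_eq_zero_of_mem_span (mul_prod_flatSumAvoiding_mem π hx hF hGF T₁) ?_
  rintro _ ⟨H, ⟨hH, hTH, hGH⟩, rfl⟩
  obtain ⟨C, hC, hHC, hfC, hCmin⟩ := exists_closure hsub hmono (H ∪ G)
  rw [mul_flatSum_pow_congr hx hH hGH
    fun K hK => ⟨fun h => hHC.trans h, fun h => hCmin K hK h⟩]
  refine hrel H C _ hH hC ⟨Finset.union_subset_left hHC,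
    fun h => hGH ((Finset.union_subset_right hHC).trans h)⟩ ?_
  rw [hfC, Finset.card_sdiff_of_subset hT₁]
  have h1 := hsub H G
  have h2 : f (F ∪ T₁.image π) ≤ f (H ∩ G) := by
    refine hmono _ _ (Finset.subset_inter hTH (subset_trans ?_ hTG))
    exact Finset.union_subset_union_right (Finset.image_subset_image hT₁)
  have h3 : f F + T₁.card ≤ f (F ∪ T₁.image π) := by
    rcases T₁.eq_empty_or_nonempty with rfl | hne
    · simp
    · refine (hmin T₁ (hT₁.ssubset_of_ne ?_) hne).le
      rintro rfl
      exact hGH (hGmin H hH hTH)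
  have h4 := Finset.card_le_card hT₁
  omega

/-- The monomial relations of the Bergman fan imply the power relations of the
Pagaria–Pezzoli ring. -/
lemma mul_flatSum_pow_eq_zero [Fintype Et] (π : Et → E)
    (hsub : ∀ A B : Finset E, f (A ∪ B) + f (A ∩ B) ≤ f A + f B)
    (hmono : ∀ A B : Finset E, A ⊆ B → f A ≤ f B) (hnorm : f ∅ = 0)
    (hfiber : ∀ i : E, (Finset.univ.filter (fun x => π x = i)).card = f {i})
    (hx : ChainSupported f x)
    (hrel : ∀ (F : Finset E) (T : Finset Et), IsFlat f F → F ≠ Finset.univ → T.Nonempty →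
      (∀ t ∈ T, π t ∉ F) → f (F ∪ T.image π) ≤ f F + T.card →
      x F * ∏ t ∈ T, flatSum f x {π t} = 0)
    {H G : Finset E} (hH : IsFlat f H) (hHG : H ⊂ G) {b : ℕ} (hb : f G - f H ≤ b) :
    x H * flatSum f x G ^ b = 0 := by
  obtain ⟨T, hTG, hcard, hK⟩ := exists_relative_basis π hsub hmono hnorm hfiber H G
  rw [Finset.union_eq_right.2 hHG.subset] at hTG hcard
  have hbT : T.card ≤ b := by omega
  suffices h : x H * flatSum f x G ^ T.card = 0 by
    rw [← Nat.add_sub_cancel' hbT, pow_add, ← mul_assoc, h, zero_mul]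
  rw [← Finset.prod_const, Finset.prod_congr rfl fun t ht =>
    (eq_sub_of_add_eq (flatSum_eq_add_flatSumAvoiding (f := f) (x := x)
      (Finset.singleton_subset_iff.2 (hTG t ht))).symm).trans
      ((sub_eq_add_neg _ _).trans (add_comm _ _)), Finset.prod_add, Finset.mul_sum]
  refine Finset.sum_eq_zero fun T₁ hT₁ => ?_
  rw [Finset.mem_powerset] at hT₁
  rw [Finset.prod_neg, mul_assoc, mul_left_comm, ← mul_assoc (x H)]
  refine mul_eq_zero_of_right _ (mul_eq_zero_of_mem_span
    (mul_prod_flatSumAvoiding_mem π hx hH hHG.not_subset T₁) ?_)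
  rintro _ ⟨K, ⟨hKf, hTK, hGK⟩, rfl⟩
  set T₂ := T.filter (fun t => π t ∉ K) with hT₂
  have hsubset : T₂ ⊆ T \ T₁ := fun t ht => by
    rw [hT₂, Finset.mem_filter] at ht
    refine Finset.mem_sdiff.2 ⟨ht.1, fun h => ht.2 (hTK ?_)⟩
    exact Finset.mem_union_right _ (Finset.mem_image_of_mem π h)
  have hKG := hK K (Finset.union_subset_left hTK)
  rw [Finset.union_eq_right.2 hHG.subset, ← hT₂] at hKG
  have hlt : f K < f (G ∪ K) := by
    obtain ⟨i, hiG, hiK⟩ := Finset.not_subset.1 hGK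
    refine (hKf i hiK).trans_le (hmono _ _ ?_)
    exact Finset.insert_subset (Finset.mem_union_left _ hiG) Finset.subset_union_right
  have hzero : x K * ∏ t ∈ T₂, flatSum f x {π t} = 0 := by
    refine hrel K T₂ hKf ?_ (Finset.card_pos.1 (by omega)) ?_ ((hmono _ _ ?_).trans hKG)
    · rintro rfl
      exact hGK (Finset.subset_univ _)
    · exact fun t ht => (Finset.mem_filter.1 ht).2
    · refine Finset.union_subset Finset.subset_union_right
        (Finset.image_subset_iff.2 fun t ht => ?_)
      exact Finset.mem_union_left _ (hTG t (Finset.mem_filter.1 ht).1)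
  rw [← Finset.prod_sdiff hsubset, mul_left_comm, hzero, mul_zero]

lemma prod_mul_flatSum_pow_eq_zero (hx : ChainSupported f x) (hx0 : x ∅ = 1)
    (hflat : IsFlat f ∅)
    (hrel : ∀ (H G : Finset E) (b : ℕ), IsFlat f H → H ⊂ G → f G - f H ≤ b →
      x H * flatSum f x G ^ b = 0)
    (G : FlatVar f) (S : Finset (FlatVar f)) (b : ℕ)
    (hb : f G.1 - f ((S.filter (fun G' => G'.1 ⊂ G.1)).sup (fun G' => G'.1)) ≤ b) :
    (∏ G' ∈ S, x G'.1) * flatSum f x G.1 ^ b = 0 := by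
  rw [← Finset.prod_filter_mul_prod_filter_not S (fun G' => G'.1 ⊂ G.1), mul_right_comm]
  refine mul_eq_zero_of_left ?_ _
  rcases prod_eq_zero_or_sup_mem hx (S.filter (fun G' => G'.1 ⊂ G.1)) with h | h | ⟨K, hK, h⟩
  · rw [h, zero_mul]
  · rw [h] at hb ⊢
    rw [Finset.prod_empty, ← hx0]
    exact hrel ∅ G.1 b hflat (Finset.empty_ssubset.2 G.2.2) hb
  · rw [h] at hb
    rw [← Finset.mul_prod_erase _ _ hK, mul_right_comm,
      hrel K.1 G.1 b K.2.1 (Finset.mem_filter.1 hK).2 hb, zero_mul]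

lemma flatSum_singleton [Nonempty E] (i : E) :
    flatSum f x {i} = x Finset.univ +
      ∑ F ∈ Finset.univ.filter (fun F : PFlatVar f => i ∈ F.1), x F.1 := by
  let top : FlatVar f := ⟨Finset.univ, fun i hi => absurd (Finset.mem_univ i) hi,
    Finset.univ_nonempty⟩
  have htop : top ∈ Finset.univ.filter (fun H : FlatVar f => {i} ⊆ H.1) :=
    Finset.mem_filter.2 ⟨Finset.mem_univ _, Finset.subset_univ _⟩
  rw [flatSum, ← Finset.add_sum_erase _ _ htop]
  congr 1
  symm
  refine Finset.sum_bij (fun F _ => ⟨F.1, F.2.1, F.2.2.1⟩) (fun F hF => ?_)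
    (fun F _ F' _ h => Subtype.ext (congrArg (fun H : FlatVar f => H.1) h))
    (fun H hH => ?_) fun _ _ => rfl
  · refine Finset.mem_erase.2 ⟨fun h => F.2.2.2 (congrArg Subtype.val h), ?_⟩
    exact Finset.mem_filter.2 ⟨Finset.mem_univ _,
      Finset.singleton_subset_iff.2 (Finset.mem_filter.1 hF).2⟩
  · obtain ⟨h1, h2⟩ := Finset.mem_erase.1 hH
    refine ⟨⟨H.1, H.2.1, H.2.2, fun h => h1 (Subtype.ext h)⟩, ?_, rfl⟩
    exact Finset.mem_filter.2 ⟨Finset.mem_univ _,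
      Finset.singleton_subset_iff.1 (Finset.mem_filter.1 h2).2⟩

end ChainSupported

section Rings

variable {E Et : Type*} [Fintype E] [Fintype Et] {f : Finset E → ℕ}

/-- The class of `x_F` in the Pagaria–Pezzoli ring, with `x_∅ = 1`. -/
def dpVar (f : Finset E → ℕ) (F : Finset E) :
    MvPolynomial (FlatVar f) ℤ ⧸ Ideal.span (DPrels f) :=
  if h : IsFlat f F ∧ F.Nonempty then Ideal.Quotient.mk _ (MvPolynomial.X ⟨F, h⟩) else 1

lemma dpVar_flatVar (F : FlatVar f) :
    dpVar f F.1 = Ideal.Quotient.mk (Ideal.span (DPrels f)) (MvPolynomial.X F) :=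
  dif_pos F.2

lemma dpVar_rel (G : FlatVar f) (S : Finset (FlatVar f)) (b : ℕ)
    (hb : f G.1 - f ((S.filter (fun G' => G'.1 ⊂ G.1)).sup (fun G' => G'.1)) ≤ b) :
    (∏ G' ∈ S, dpVar f G'.1) * flatSum f (dpVar f) G.1 ^ b = 0 := by
  have h := Ideal.Quotient.eq_zero_iff_mem.2
    (Ideal.subset_span (show _ ∈ DPrels f from ⟨G, S, b, hb, rfl⟩))
  rw [map_mul, map_prod, map_pow, map_sum] at h
  simpa only [flatSum, dpVar_flatVar] using h

lemma dpVar_chainSupported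
    (hsub : ∀ A B : Finset E, f (A ∪ B) + f (A ∩ B) ≤ f A + f B)
    (hmono : ∀ A B : Finset E, A ⊆ B → f A ≤ f B) : ChainSupported f (dpVar f) := by
  intro F₁ F₂ hF₁ hF₂ h₁₂ h₂₁
  have hne₁ : F₁.Nonempty := Finset.nonempty_iff_ne_empty.2 fun h => h₁₂ (by simp [h])
  have hne₂ : F₂.Nonempty := Finset.nonempty_iff_ne_empty.2 fun h => h₂₁ (by simp [h])
  obtain ⟨C, hC, hFC, hfC, -⟩ := exists_closure hsub hmono (F₁ ∪ F₂)
  have hFC₁ := Finset.union_subset_left hFC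
  have hFC₂ := Finset.union_subset_right hFC
  obtain ⟨K₁, rfl⟩ : ∃ K : FlatVar f, K.1 = F₁ := ⟨⟨F₁, hF₁, hne₁⟩, rfl⟩
  obtain ⟨K₂, rfl⟩ : ∃ K : FlatVar f, K.1 = F₂ := ⟨⟨F₂, hF₂, hne₂⟩, rfl⟩
  have hne : K₁ ≠ K₂ := fun h => h₁₂ (h ▸ subset_rfl)
  have hs : ∀ K ∈ ({K₁, K₂} : Finset (FlatVar f)), K.1 ⊂ C := by
    intro K hK
    rcases Finset.mem_insert.1 hK with rfl | hK
    · exact ⟨hFC₁, fun h => h₂₁ (hFC₂.trans h)⟩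
    · rw [Finset.mem_singleton.1 hK]
      exact ⟨hFC₂, fun h => h₁₂ (hFC₁.trans h)⟩
  have h := dpVar_rel ⟨C, hC, hne₁.mono hFC₁⟩ {K₁, K₂} 0 (by
    rw [Finset.filter_true_of_mem hs, Finset.sup_insert, Finset.sup_singleton]
    exact (Nat.sub_eq_zero_of_le hfC.le).le)
  rwa [Finset.prod_pair hne, pow_zero, mul_one] at h

lemma dpVar_mul_flatSum_pow (H G : Finset E) (b : ℕ) (hH : IsFlat f H) (hG : IsFlat f G)
    (hHG : H ⊂ G) (hb : f G - f H ≤ b) :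
    dpVar f H * flatSum f (dpVar f) G ^ b = 0 := by
  have hGne : G.Nonempty := (Finset.empty_subset H).trans_ssubset hHG |> Finset.empty_ssubset.1
  obtain ⟨L, rfl⟩ : ∃ K : FlatVar f, K.1 = G := ⟨⟨G, hG, hGne⟩, rfl⟩
  rcases H.eq_empty_or_nonempty with rfl | hne
  · have h := dpVar_rel L ∅ b (by simpa using hb)
    rw [Finset.prod_empty, one_mul] at h
    rw [h, mul_zero]
  · obtain ⟨K, rfl⟩ : ∃ K : FlatVar f, K.1 = H := ⟨⟨H, hH, hne⟩, rfl⟩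
    have hs : ∀ K' ∈ ({K} : Finset (FlatVar f)), K'.1 ⊂ L.1 := fun K' hK' => by
      rwa [Finset.mem_singleton.1 hK']
    have h := dpVar_rel L {K} b (by
      rwa [Finset.filter_true_of_mem hs, Finset.sup_singleton])
    rwa [Finset.prod_singleton] at h

/-- The class of `z_F` in the Chow ring of the Bergman fan, with `z_∅ = 1` and
`z_E = -(z_s + ∑_{F ∋ π(s)} z_F)`. -/
def chowVar (π : Et → E) (f : Finset E → ℕ) (s : Et) (F : Finset E) :
    MvPolynomial (PFlatVar f ⊕ Et) ℤ ⧸ Ideal.span (Arels π f) :=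
  Ideal.Quotient.mk _ (if F = Finset.univ then - linForm π f s else zFlat f Et F)

lemma chowVar_univ (π : Et → E) (s t : Et) : chowVar π f s Finset.univ =
    - Ideal.Quotient.mk (Ideal.span (Arels π f)) (linForm π f t) := by
  rw [chowVar, if_pos rfl, map_neg, neg_inj]
  exact Ideal.Quotient.eq.2 (Ideal.subset_span (Or.inr (Or.inr ⟨s, t, rfl⟩)))

lemma chowVar_of_ne_univ (π : Et → E) (s : Et) {F : Finset E} (hF : F ≠ Finset.univ) :
    chowVar π f s F = Ideal.Quotient.mk (Ideal.span (Arels π f)) (zFlat f Et F) := by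
  rw [chowVar, if_neg hF]

lemma chowVar_pFlatVar (π : Et → E) (s : Et) (F : PFlatVar f) : chowVar π f s F.1 =
    Ideal.Quotient.mk (Ideal.span (Arels π f)) (MvPolynomial.X (Sum.inl F)) := by
  rw [chowVar_of_ne_univ π s F.2.2.2, zFlat, dif_pos F.2]
  rfl

lemma chowVar_empty [Nonempty E] (π : Et → E) (s : Et) : chowVar π f s ∅ = 1 := by
  rw [chowVar_of_ne_univ π s Finset.univ_nonempty.ne_empty.symm, zFlat, dif_neg (by simp), map_one]

lemma chowVar_chainSupported (π : Et → E) (s : Et) : ChainSupported f (chowVar π f s) := by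
  intro F₁ F₂ hF₁ hF₂ h₁₂ h₂₁
  have hne₁ : F₁.Nonempty := Finset.nonempty_iff_ne_empty.2 fun h => h₁₂ (by simp [h])
  have hne₂ : F₂.Nonempty := Finset.nonempty_iff_ne_empty.2 fun h => h₂₁ (by simp [h])
  have hu₁ : F₁ ≠ Finset.univ := fun h => h₂₁ (by simp [h])
  have hu₂ : F₂ ≠ Finset.univ := fun h => h₁₂ (by simp [h])
  rw [chowVar_pFlatVar π s ⟨F₁, hF₁, hne₁, hu₁⟩, chowVar_pFlatVar π s ⟨F₂, hF₂, hne₂, hu₂⟩,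
    ← map_mul]
  exact Ideal.Quotient.eq_zero_iff_mem.2
    (Ideal.subset_span (Or.inl ⟨_, _, h₁₂, h₂₁, rfl⟩))

lemma flatSum_chowVar_singleton [Nonempty E] (π : Et → E) (s t : Et) :
    flatSum f (chowVar π f s) {π t} =
      - Ideal.Quotient.mk (Ideal.span (Arels π f)) (MvPolynomial.X (Sum.inr t)) := by
  rw [flatSum_singleton, chowVar_univ π s t, linForm, map_add, map_sum]
  simp only [chowVar_pFlatVar]
  ring

lemma chowVar_mul_prod [Nonempty E] (π : Et → E) (s : Et) (F : Finset E) (T : Finset Et)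
    (hF : IsFlat f F) (hu : F ≠ Finset.univ) (hT : T.Nonempty) (hTF : ∀ t ∈ T, π t ∉ F)
    (hrank : f (F ∪ T.image π) ≤ f F + T.card) :
    chowVar π f s F * ∏ t ∈ T, flatSum f (chowVar π f s) {π t} = 0 := by
  have h := Ideal.Quotient.eq_zero_iff_mem.2 (Ideal.subset_span
    (show _ ∈ Arels π f from Or.inr (Or.inl ⟨F, T, hF, hu, hT, hTF, hrank, rfl⟩)))
  rw [map_mul, map_prod] at h
  simp only [flatSum_chowVar_singleton, chowVar_of_ne_univ π s hu]
  exact mul_prod_neg_eq_zero h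

end Rings

/-- the Pagaria–Pezzoli Chow ring of a loopless polymatroid is isomorphic
to the Chow ring of its Bergman fan, via `x_F ↦ z_F` for proper flats and
`x_E ↦ −(z_s + ∑_{F ∋ π(s)} z_F)`. -/
theorem dp_iso_bergman_chow {E Et : Type*} [Fintype E] [Fintype Et] [Nonempty E]
    (π : Et → E) (hπ : Function.Surjective π) (f : Finset E → ℕ)
    (hsub : ∀ A B : Finset E, f (A ∪ B) + f (A ∩ B) ≤ f A + f B)
    (hmono : ∀ A B : Finset E, A ⊆ B → f A ≤ f B)
    (hnorm : f ∅ = 0)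
    (hloopless : ∀ A : Finset E, A.Nonempty → 0 < f A)
    (hfiber : ∀ i : E, (Finset.univ.filter (fun x => π x = i)).card = f {i}) :
    ∃ φ : (MvPolynomial (FlatVar f) ℤ ⧸ Ideal.span (DPrels f)) ≃+*
          (MvPolynomial (PFlatVar f ⊕ Et) ℤ ⧸ Ideal.span (Arels π f)),
      (∀ (F : Finset E) (hF : IsFlat f F) (hne : F.Nonempty) (hpr : F ≠ Finset.univ),
          φ (Ideal.Quotient.mk (Ideal.span (DPrels f))
              (MvPolynomial.X (⟨F, hF, hne⟩ : FlatVar f)))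
            = Ideal.Quotient.mk (Ideal.span (Arels π f))
                (MvPolynomial.X (Sum.inl (⟨F, hF, hne, hpr⟩ : PFlatVar f)))) ∧
      (∀ s : Et,
          φ (Ideal.Quotient.mk (Ideal.span (DPrels f))
              (MvPolynomial.X
                (⟨Finset.univ, fun i hi => absurd (Finset.mem_univ i) hi,
                  Finset.univ_nonempty⟩ : FlatVar f)))
            = - Ideal.Quotient.mk (Ideal.span (Arels π f)) (linForm π f s)) := by
  obtain ⟨s₀, -⟩ := hπ (Classical.arbitrary E)
  have hflat : IsFlat f ∅ := fun i _ => hnorm.symm ▸ hloopless _ (Finset.insert_nonempty i ∅)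
  let φ₀ : MvPolynomial (FlatVar f) ℤ →+*
      (MvPolynomial (PFlatVar f ⊕ Et) ℤ ⧸ Ideal.span (Arels π f)) :=
    MvPolynomial.eval₂Hom (Int.castRingHom _) (fun F => chowVar π f s₀ F.1)
  let ψ₀ : MvPolynomial (PFlatVar f ⊕ Et) ℤ →+*
      (MvPolynomial (FlatVar f) ℤ ⧸ Ideal.span (DPrels f)) :=
    MvPolynomial.eval₂Hom (Int.castRingHom _)
      (Sum.elim (fun F => dpVar f F.1) (fun t => - flatSum f (dpVar f) {π t}))
  have hφX : ∀ F : FlatVar f, φ₀ (MvPolynomial.X F) = chowVar π f s₀ F.1 := fun F =>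
    MvPolynomial.eval₂Hom_X' _ _ _
  have hψl : ∀ F : PFlatVar f, ψ₀ (MvPolynomial.X (Sum.inl F)) = dpVar f F.1 := fun F =>
    MvPolynomial.eval₂Hom_X' _ _ _
  have hψr : ∀ t : Et, ψ₀ (MvPolynomial.X (Sum.inr t)) = - flatSum f (dpVar f) {π t} := fun t =>
    MvPolynomial.eval₂Hom_X' _ _ _
  have hψlin : ∀ t : Et, ψ₀ (linForm π f t) = - dpVar f Finset.univ := fun t => by
    rw [linForm, map_add, map_sum, hψr, flatSum_singleton]
    simp only [hψl]
    ring
  have hψz : ∀ F : Finset E, IsFlat f F → F ≠ Finset.univ → ψ₀ (zFlat f Et F) = dpVar f F := by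
    intro F hF hu
    by_cases hne : F.Nonempty
    · rw [zFlat, dif_pos ⟨hF, hne, hu⟩]
      exact hψl ⟨F, hF, hne, hu⟩
    · rw [zFlat, dif_neg fun h => hne h.2.1, map_one, dpVar, dif_neg fun h => hne h.2]
  have hφ : Ideal.span (DPrels f) ≤ RingHom.ker φ₀ := by
    rw [Ideal.span_le]
    rintro _ ⟨G, S, b, hb, rfl⟩
    have h := prod_mul_flatSum_pow_eq_zero (chowVar_chainSupported π s₀) (chowVar_empty π s₀)
      hflat (fun H G b hH hHG hb => mul_flatSum_pow_eq_zero π hsub hmono hnorm hfiber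
        (chowVar_chainSupported π s₀) (chowVar_mul_prod π s₀) hH hHG hb) G S b hb
    change φ₀ _ = 0
    rw [map_mul, map_prod, map_pow, map_sum]
    simpa only [hφX, flatSum] using h
  have hψ : Ideal.span (Arels π f) ≤ RingHom.ker ψ₀ := by
    rw [Ideal.span_le]
    rintro _ (⟨F₁, F₂, h₁₂, h₂₁, rfl⟩ | ⟨F, T, hF, hu, hT, hTF, hrank, rfl⟩ | ⟨s, t, rfl⟩)
    · change ψ₀ _ = 0
      rw [map_mul, hψl, hψl]
      exact dpVar_chainSupported hsub hmono _ _ F₁.2.1 F₂.2.1 h₁₂ h₂₁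
    · change ψ₀ _ = 0
      rw [map_mul, map_prod, hψz F hF hu]
      simp only [hψr]
      exact mul_prod_neg_eq_zero (mul_prod_flatSum_eq_zero π hsub hmono
        (dpVar_chainSupported hsub hmono) dpVar_mul_flatSum_pow hF T hT hTF hrank)
    · change ψ₀ _ = 0
      rw [map_sub, hψlin, hψlin, sub_self]
  let φ := Ideal.Quotient.lift _ φ₀ fun a ha => hφ ha
  let ψ := Ideal.Quotient.lift _ ψ₀ fun a ha => hψ ha
  have hφmk : ∀ a, φ (Ideal.Quotient.mk _ a) = φ₀ a := fun a => Ideal.Quotient.lift_mk _ _ _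
  have hψmk : ∀ a, ψ (Ideal.Quotient.mk _ a) = ψ₀ a := fun a => Ideal.Quotient.lift_mk _ _ _
  have hφdp : ∀ F : FlatVar f, φ (dpVar f F.1) = chowVar π f s₀ F.1 := fun F => by
    rw [dpVar_flatVar, hφmk, hφX]
  have hφψ : φ.comp ψ = RingHom.id _ := by
    refine Ideal.Quotient.ringHom_ext (MvPolynomial.ringHom_ext (fun n => by simp) ?_)
    rintro (F | t)
    · simp only [RingHom.comp_apply, RingHom.id_apply, hψmk, hψl]
      rw [hφdp ⟨F.1, F.2.1, F.2.2.1⟩, chowVar_pFlatVar]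
    · simp only [RingHom.comp_apply, RingHom.id_apply, hψmk, hψr]
      rw [map_neg, flatSum, map_sum, Finset.sum_congr rfl fun F _ => hφdp F]
      exact neg_eq_iff_eq_neg.2 (flatSum_chowVar_singleton π s₀ t)
  have hψφ : ψ.comp φ = RingHom.id _ := by
    refine Ideal.Quotient.ringHom_ext (MvPolynomial.ringHom_ext (fun n => by simp) fun F => ?_)
    simp only [RingHom.comp_apply, RingHom.id_apply, hφmk, hφX]
    rw [← dpVar_flatVar]
    by_cases hu : F.1 = Finset.univ
    · rw [hu, chowVar_univ π s₀ s₀, map_neg, hψmk, hψlin, neg_neg]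
    · rw [chowVar_of_ne_univ π s₀ hu, hψmk, hψz F.1 F.2.1 hu]
  refine ⟨RingEquiv.ofRingHom φ ψ hφψ hψφ, fun F hF hne hpr => ?_, fun s => ?_⟩
  · exact (hφmk _).trans ((hφX _).trans (chowVar_pFlatVar π s₀ ⟨F, hF, hne, hpr⟩))
  · exact (hφmk _).trans ((hφX _).trans (chowVar_univ π s₀ s))

end
end

section
/- Let f be a loopless polymatroid rank function on a finite nonempty set E of rank r = f(E), and let DP(f) be the quotient of ℤ[x_F : F a nonempty flat of f] by the (homogeneous) ideal generated by all elements (∏_{G'∈𝒮} x_{G'})·(∑_{flats H with H ⊇ G} x_H)^b, where G ranges over nonempty flats, 𝒮 over finite collections of nonempty flats, and b over natural numbers with b ≥ f(G) − f(⋃{G' ∈ 𝒮 : G' ⊊ G}). For k ≥ 0 let DP^k(f) ⊆ DP(f) be the ℤ-submodule spanned by the residue classes of the homogeneous degree-k polynomials. Then (Poincaré duality): DP^{r−1}(f) is a free ℤ-module of rank 1, and for every k with 0 ≤ k < r/2 the multiplication pairing DP^k(f) × DP^{r−1−k}(f) → DP^{r−1}(f), (a,b) ↦ ab, is non-degenerate: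 every nonzero a ∈ DP^k(f) has some b ∈ DP^{r−1−k}(f) with ab ≠ 0, and every nonzero b ∈ DP^{r−1−k}(f) has some a ∈ DP^k(f) with ab ≠ 0. -/
open scoped Classical

noncomputable section

/-- The degree-`k` graded piece of `DP(f)`: the ℤ-submodule spanned by residues of
homogeneous degree-`k` polynomials. -/
def DPgrade {E : Type*} [Fintype E] (f : Finset E → ℕ) (k : ℕ) :
    Submodule ℤ (MvPolynomial (FlatVar f) ℤ ⧸ Ideal.span (DPrels f)) :=
  Submodule.span ℤ
    (Ideal.Quotient.mk (Ideal.span (DPrels f)) ''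
      {p : MvPolynomial (FlatVar f) ℤ | p.IsHomogeneous k})

/-- Rank functions of loopless polymatroids. -/
structure IsLooplessRank {E : Type*} (f : Finset E → ℕ) : Prop where
  submod : ∀ A B : Finset E, f (A ∪ B) + f (A ∩ B) ≤ f A + f B
  mono : ∀ A B : Finset E, A ⊆ B → f A ≤ f B
  empty : f ∅ = 0
  pos : ∀ A : Finset E, A.Nonempty → 0 < f A

namespace IsLooplessRank

variable {E : Type*} [Fintype E] {f : Finset E → ℕ}

/-- Every nonempty set has a closure: a flat of the same rank contained in every flat
above the set. -/
theorem exists_closure (hf : IsLooplessRank f) {A : Finset E} (hA : A.Nonempty) :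
    ∃ K : FlatVar f, A ⊆ K.1 ∧ f K.1 = f A ∧ ∀ H : FlatVar f, A ⊆ H.1 → K.1 ⊆ H.1 := by
  obtain ⟨K, hK, hmax⟩ := Finset.exists_max_image
    (Finset.univ.filter fun K : Finset E => A ⊆ K ∧ f K = f A) Finset.card ⟨A, by simp⟩
  simp only [Finset.mem_filter, Finset.mem_univ, true_and] at hK hmax
  have hflat : IsFlat f K := by
    intro i hi
    refine lt_of_le_of_ne (hf.mono _ _ (Finset.subset_insert _ _)) fun h => ?_
    have := hmax (insert i K) ⟨hK.1.trans (Finset.subset_insert _ _), h ▸ hK.2⟩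
    rw [Finset.card_insert_of_notMem hi] at this
    omega
  refine ⟨⟨K, hflat, hA.mono hK.1⟩, hK.1, hK.2, fun H hH i hi => ?_⟩
  by_contra hiH
  have h1 := H.2.1 i hiH
  have h2 := hf.submod H.1 K
  have h3 := hf.mono (insert i H.1) (H.1 ∪ K)
    (Finset.insert_subset (Finset.mem_union_right _ hi) Finset.subset_union_left)
  have h4 := hf.mono A (H.1 ∩ K) (Finset.subset_inter hH hK.1)
  have := hK.2
  omega

omit [Fintype E] in
theorem lt_of_ssubset (hf : IsLooplessRank f) {F : FlatVar f} {A : Finset E} (h : F.1 ⊂ A) :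
    f F.1 < f A := by
  obtain ⟨i, hi, hiF⟩ := Finset.exists_of_ssubset h
  exact (F.2.1 i hiF).trans_le (hf.mono _ _ (Finset.insert_subset hi h.1))

end IsLooplessRank

section Chow

variable {E : Type*} [Fintype E] {f : Finset E → ℕ}

namespace FlatVar

omit [Fintype E] in
theorem ext_set {F G : FlatVar f} (h : F.1 = G.1) : F = G := Subtype.ext h

omit [Fintype E] in
theorem ssubset_of_subset_of_ne {F G : FlatVar f} (h : F.1 ⊆ G.1) (hne : F ≠ G) : F.1 ⊂ G.1 :=
  h.ssubset_of_ne fun he => hne (ext_set he)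

theorem downward_induction {P : FlatVar f → Prop}
    (h : ∀ F, (∀ H : FlatVar f, F.1 ⊂ H.1 → P H) → P F) (F : FlatVar f) : P F := by
  induction hn : Fintype.card E - F.1.card using Nat.strong_induction_on generalizing F with
  | _ n ih =>
    refine h F fun H hH => ih _ ?_ H rfl
    have h1 := Finset.card_lt_card hH
    have h2 := Finset.card_le_univ H.1
    omega

variable [Nonempty E]

/-- The ground set as a flat. -/
def top (f : Finset E → ℕ) : FlatVar f :=
  ⟨Finset.univ, fun i hi => absurd (Finset.mem_univ i) hi, Finset.univ_nonempty⟩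

@[simp] theorem top_val : (top f).1 = Finset.univ := rfl

theorem ssubset_top {F : FlatVar f} (h : F ≠ top f) : F.1 ⊂ Finset.univ :=
  ssubset_of_subset_of_ne (G := top f) (Finset.subset_univ _) h

/-- A proper flat is properly contained only in flats; the ground set is contained in none. -/
theorem ne_top_of_ssubset {F : FlatVar f} {A : Finset E} (h : F.1 ⊂ A) : F ≠ top f := by
  rintro rfl
  exact h.2 (Finset.subset_univ _)

end FlatVar

/-- The degree of the exponent `W` in the flats contained in `A`. -/
def degBelow (A : Finset E) (W : FlatVar f →₀ ℕ) : ℕ :=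
  ∑ G : FlatVar f with G.1 ⊆ A, W G

@[simp] theorem degBelow_zero (A : Finset E) : degBelow A (0 : FlatVar f →₀ ℕ) = 0 := by
  simp [degBelow]

@[simp] theorem degBelow_add (A : Finset E) (W W' : FlatVar f →₀ ℕ) :
    degBelow A (W + W') = degBelow A W + degBelow A W' := by
  simp [degBelow, Finset.sum_add_distrib]

theorem degBelow_single (A : Finset E) (G : FlatVar f) (b : ℕ) :
    degBelow A (Finsupp.single G b) = if G.1 ⊆ A then b else 0 := by
  simp [degBelow, Finsupp.single_apply, Finset.sum_ite_eq]

theorem degBelow_mono {A B : Finset E} (h : A ⊆ B) (W : FlatVar f →₀ ℕ) :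
    degBelow A W ≤ degBelow B W :=
  Finset.sum_le_sum_of_subset fun G hG => by
    simp only [Finset.mem_filter, Finset.mem_univ, true_and] at hG ⊢
    exact hG.trans h

theorem degBelow_univ (W : FlatVar f →₀ ℕ) : degBelow Finset.univ W = W.degree := by
  simp [degBelow, Finsupp.degree_eq_sum]

theorem degBelow_supermodular (A B : Finset E) (W : FlatVar f →₀ ℕ) :
    degBelow A W + degBelow B W ≤ degBelow (A ∪ B) W + degBelow (A ∩ B) W := by
  simp only [degBelow, Finset.sum_filter, ← Finset.sum_add_distrib]
  refine Finset.sum_le_sum fun G _ => ?_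
  by_cases hA : G.1 ⊆ A
  · have : G.1 ⊆ A ∪ B := hA.trans Finset.subset_union_left
    by_cases hB : G.1 ⊆ B <;> simp [hA, hB, this, Finset.subset_inter_iff]
  · by_cases hB : G.1 ⊆ B
    · have : G.1 ⊆ A ∪ B := hB.trans Finset.subset_union_right
      simp [hA, hB, this]
    · simp [hA, hB]

/-- The dragon Hall–Rado condition on a multiset of flats. -/
def DragonIndep (W : FlatVar f →₀ ℕ) : Prop :=
  ∀ A : Finset E, A.Nonempty → degBelow A W + 1 ≤ f A

/-- The conditions under which a multiset of flats splits at `F` into a dragon Hall–Rado basis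
of the restriction to `F` and one of the contraction by `F`. -/
structure SplitsAt (F : FlatVar f) (W : FlatVar f →₀ ℕ) : Prop where
  total : degBelow Finset.univ W + 2 = f Finset.univ
  tight : degBelow F.1 W + 1 = f F.1
  below : ∀ A : Finset E, A.Nonempty → A ⊆ F.1 → degBelow A W + 1 ≤ f A
  above : ∀ H : FlatVar f, F.1 ⊂ H.1 → degBelow H.1 W + 2 ≤ f H.1

theorem SplitsAt.above_set (hf : IsLooplessRank f) {F : FlatVar f} {W : FlatVar f →₀ ℕ}
    (h : SplitsAt F W) {A : Finset E} (hA : F.1 ⊂ A) : degBelow A W + 2 ≤ f A := by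
  obtain ⟨K, hK, hfK, -⟩ := hf.exists_closure (F.2.2.mono hA.1)
  have := h.above K (hA.trans_subset hK)
  have := degBelow_mono hK W
  omega

theorem SplitsAt.dragonIndep (hf : IsLooplessRank f) {F : FlatVar f} {W : FlatVar f →₀ ℕ}
    (h : SplitsAt F W) : DragonIndep W := by
  intro A hA
  by_cases hAF : A ⊆ F.1
  · exact h.below A hA hAF
  have h1 := h.above_set hf (A := A ∪ F.1)
    ⟨Finset.subset_union_right, fun h' => hAF (Finset.subset_union_left.trans h')⟩
  have h2 := degBelow_supermodular A F.1 W
  have h3 := hf.submod A F.1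
  have h4 : degBelow (A ∩ F.1) W ≤ f (A ∩ F.1) := by
    rcases (A ∩ F.1).eq_empty_or_nonempty with h0 | h0
    · rw [h0, degBelow, Finset.sum_eq_zero]
      · simp
      · intro G hG
        simp only [Finset.mem_filter, Finset.mem_univ, true_and, Finset.subset_empty] at hG
        exact absurd hG G.2.2.ne_empty
    · have := h.below _ h0 Finset.inter_subset_right
      omega
  have := h.tight
  omega

theorem SplitsAt.eq_of_subset (hf : IsLooplessRank f) {F F' G : FlatVar f} {W : FlatVar f →₀ ℕ}
    (h : SplitsAt F W) (h' : SplitsAt F' W) (hG : G.1 ⊆ F.1) (hG' : G.1 ⊆ F'.1) : F = F' := by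
  have hI := h.dragonIndep hf (F.1 ∩ F'.1) (G.2.2.mono (Finset.subset_inter hG hG'))
  have h2 := degBelow_supermodular F.1 F'.1 W
  have h3 := hf.submod F.1 F'.1
  have t := h.tight
  have t' := h'.tight
  by_contra hne
  by_cases hs : F'.1 ⊆ F.1
  · have := h'.above_set hf (FlatVar.ssubset_of_subset_of_ne hs (Ne.symm hne))
    omega
  · have := h.above_set hf (A := F.1 ∪ F'.1)
      ⟨Finset.subset_union_left, fun h' => hs (Finset.subset_union_right.trans h')⟩
    omega

theorem exists_splitsAt (hf : IsLooplessRank f) {G : FlatVar f}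
    {W : FlatVar f →₀ ℕ} (ht : degBelow Finset.univ W + 2 = f Finset.univ)
    (hW : DragonIndep W) (hWG : ¬ DragonIndep (W + Finsupp.single G 1)) :
    ∃ F, G.1 ⊆ F.1 ∧ SplitsAt F W := by
  simp only [DragonIndep, not_forall, not_le, degBelow_add, degBelow_single] at hWG
  obtain ⟨A, hA, hlt⟩ := hWG
  have hWA := hW A hA
  have hGA : G.1 ⊆ A := by
    by_contra h
    simp [h] at hlt
    omega
  simp only [hGA, if_true] at hlt
  obtain ⟨K, hK, hfK, -⟩ := hf.exists_closure hA
  have hKt : degBelow K.1 W + 1 = f K.1 := by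
    have := hW K.1 K.2.2
    have := degBelow_mono hK W
    omega
  obtain ⟨F, hF, hmax⟩ := Finset.exists_max_image
    (Finset.univ.filter fun F : FlatVar f => G.1 ⊆ F.1 ∧ degBelow F.1 W + 1 = f F.1)
    (fun F => F.1.card) ⟨K, by simp [hGA.trans hK, hKt]⟩
  simp only [Finset.mem_filter, Finset.mem_univ, true_and] at hF hmax
  refine ⟨F, hF.1, ht, hF.2, fun A hA _ => hW A hA, fun H hH => ?_⟩
  have h1 := hW H.1 H.2.2
  by_contra h
  have := hmax H ⟨hF.1.trans hH.1, by omega⟩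
  have := Finset.card_lt_card hH
  omega

/-- The degree of a monomial in the generators `∑_{H ⊇ G} x_H`. -/
def hCoeff (W : FlatVar f →₀ ℕ) : ℤ :=
  if degBelow Finset.univ W + 1 = f Finset.univ ∧ DragonIndep W then 1 else 0

variable [Nonempty E]

theorem hCoeff_add_top (W : FlatVar f →₀ ℕ) :
    hCoeff (W + Finsupp.single (FlatVar.top f) 1) =
      if degBelow Finset.univ W + 2 = f Finset.univ ∧ DragonIndep W then 1 else 0 := by
  unfold hCoeff
  congr 1
  simp only [degBelow_add, degBelow_single, FlatVar.top_val, subset_refl, if_true, eq_iff_iff]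
  refine and_congr_right fun ht => ⟨fun h A hA => ?_, fun h A hA => ?_⟩
  · have := h A hA
    rw [degBelow_add] at this
    omega
  · have := h A hA
    rw [degBelow_add, degBelow_single, FlatVar.top_val]
    split_ifs with hs
    · rw [Finset.univ_subset_iff] at hs
      subst hs
      omega
    · omega

theorem hCoeff_add_single (hf : IsLooplessRank f) (G : FlatVar f) (W : FlatVar f →₀ ℕ) :
    hCoeff (W + Finsupp.single G 1) = hCoeff (W + Finsupp.single (FlatVar.top f) 1) -
      ∑ F : FlatVar f with G.1 ⊆ F.1 ∧ F ≠ FlatVar.top f, if SplitsAt F W then 1 else 0 := by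
  rw [hCoeff_add_top]
  by_cases ht : degBelow Finset.univ W + 2 = f Finset.univ
  swap
  · rw [Finset.sum_eq_zero fun F _ => if_neg fun h => ht h.total, if_neg fun h => ht h.1,
      hCoeff, if_neg]
    · simp
    · simp only [degBelow_add, degBelow_single, Finset.subset_univ, if_true]
      exact fun h => ht h.1
  by_cases hW : DragonIndep W
  swap
  · rw [Finset.sum_eq_zero fun F _ => if_neg fun h => hW (h.dragonIndep hf), if_neg fun h => hW h.2,
      hCoeff, if_neg]
    · simp
    · refine fun h => hW fun A hA => ?_
      have := h.2 A hA
      simp only [degBelow_add] at this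
      omega
  have htG : degBelow Finset.univ (W + Finsupp.single G 1) + 1 = f Finset.univ := by
    simp only [degBelow_add, degBelow_single, Finset.subset_univ, if_true]
    exact ht
  by_cases hWG : DragonIndep (W + Finsupp.single G 1)
  · rw [Finset.sum_eq_zero, hCoeff, if_pos ⟨htG, hWG⟩, if_pos ⟨ht, hW⟩, sub_zero]
    · intro F hF
      simp only [Finset.mem_filter, Finset.mem_univ, true_and] at hF
      refine if_neg fun h => ?_
      have := hWG F.1 F.2.2
      simp only [degBelow_add, degBelow_single, hF.1, if_true] at this
      have := h.tight
      omega
  · obtain ⟨F, hGF, hF⟩ := exists_splitsAt hf ht hW hWG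
    have hFt : F ≠ FlatVar.top f := by
      rintro rfl
      have := hF.tight
      have := hF.total
      simp only [FlatVar.top_val] at *
      omega
    rw [Finset.sum_eq_single_of_mem F (by simp [hGF, hFt]), hCoeff]
    · simp [ht, hW, hWG, hF]
    · intro F' hF' hne
      simp only [Finset.mem_filter, Finset.mem_univ, true_and] at hF'
      exact if_neg fun h => hne (h.eq_of_subset hf hF hF'.1 hGF)

omit [Nonempty E] in
theorem sum_superset {M : Type*} [AddCommMonoid M] (g : FlatVar f → M) (G : FlatVar f) :
    ∑ H : FlatVar f with G.1 ⊆ H.1, g H = g G + ∑ H : FlatVar f with G.1 ⊂ H.1, g H := by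
  have : Finset.univ.filter (fun H : FlatVar f => G.1 ⊆ H.1) =
      insert G (Finset.univ.filter fun H : FlatVar f => G.1 ⊂ H.1) := by
    ext H
    simp only [Finset.mem_filter, Finset.mem_univ, true_and, Finset.mem_insert]
    refine ⟨fun h => ?_, ?_⟩
    · by_cases he : H = G
      · exact Or.inl he
      · exact Or.inr (FlatVar.ssubset_of_subset_of_ne h (Ne.symm he))
    · rintro (rfl | h)
      · exact subset_rfl
      · exact h.1
  rw [this, Finset.sum_insert (by simp)]

open MvPolynomial

/-- The variable `x_F` written in terms of the generators `h_G = ∑_{H ⊇ G} x_H`. -/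
def flatGen (F : FlatVar f) : MvPolynomial (FlatVar f) ℤ :=
  X F - ∑ H : {H : FlatVar f // F.1 ⊂ H.1}, flatGen H.1
termination_by Fintype.card E - F.1.card
decreasing_by
  have h1 := Finset.card_lt_card H.2
  have h2 := Finset.card_le_univ H.1.1
  omega

omit [Nonempty E] in
theorem flatGen_eq (F : FlatVar f) :
    flatGen F = X F - ∑ H : FlatVar f with F.1 ⊂ H.1, flatGen H := by
  rw [flatGen, Finset.sum_subtype (p := fun H : FlatVar f => F.1 ⊂ H.1) _ (by simp) flatGen]

omit [Nonempty E] in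
theorem sum_flatGen (G : FlatVar f) : ∑ H : FlatVar f with G.1 ⊆ H.1, flatGen H = X G := by
  rw [sum_superset, flatGen_eq, sub_add_cancel]

theorem flatGen_top : flatGen (FlatVar.top f) = X (FlatVar.top f) := by
  rw [flatGen_eq, Finset.sum_eq_zero, sub_zero]
  intro H hH
  simp only [Finset.mem_filter, Finset.mem_univ, true_and] at hH
  exact absurd rfl (FlatVar.ne_top_of_ssubset hH)

/-- The degree map in the generators `h_G`. -/
def hDeg (f : Finset E → ℕ) : MvPolynomial (FlatVar f) ℤ →ₗ[ℤ] ℤ :=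
  (basisMonomials (FlatVar f) ℤ).constr ℤ hCoeff

omit [Nonempty E] in
@[simp] theorem hDeg_monomial (W : FlatVar f →₀ ℕ) : hDeg f (monomial W 1) = hCoeff W := by
  have := (basisMonomials (FlatVar f) ℤ).constr_basis ℤ hCoeff W
  rwa [coe_basisMonomials] at this

omit [Nonempty E] in
theorem hDeg_X_mul (G : FlatVar f) (W : FlatVar f →₀ ℕ) :
    hDeg f (X G * monomial W 1) = hCoeff (W + Finsupp.single G 1) := by
  rw [X, monomial_mul, one_mul, hDeg_monomial, add_comm]

theorem hDeg_flatGen_mul (hf : IsLooplessRank f) (F : FlatVar f) (hF : F ≠ FlatVar.top f)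
    (W : FlatVar f →₀ ℕ) :
    hDeg f (flatGen F * monomial W 1) = - if SplitsAt F W then 1 else 0 := by
  induction F using FlatVar.downward_induction with
  | _ F ih =>
  have hE : (Finset.univ.filter fun H : FlatVar f => F.1 ⊂ H.1) =
      insert (FlatVar.top f) (Finset.univ.filter fun H : FlatVar f =>
        F.1 ⊂ H.1 ∧ H ≠ FlatVar.top f) := by
    ext H
    by_cases h : H = FlatVar.top f
    · simp [h, FlatVar.ssubset_top hF]
    · simp [h]
  have hE' : (Finset.univ.filter fun H : FlatVar f => F.1 ⊆ H.1 ∧ H ≠ FlatVar.top f) =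
      insert F (Finset.univ.filter fun H : FlatVar f =>
        F.1 ⊂ H.1 ∧ H ≠ FlatVar.top f) := by
    ext H
    by_cases h : H = F
    · simp [h, hF]
    · have : F.1 ⊆ H.1 ↔ F.1 ⊂ H.1 :=
        ⟨fun hs => FlatVar.ssubset_of_subset_of_ne hs (Ne.symm h), fun hs => hs.1⟩
      simp [h, this]
  have key := hCoeff_add_single hf F W
  rw [hE', Finset.sum_insert (by simp)] at key
  have hsum : ∑ H : FlatVar f with F.1 ⊂ H.1 ∧ H ≠ FlatVar.top f,
      hDeg f (flatGen H * monomial W 1) =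
      - ∑ H : FlatVar f with F.1 ⊂ H.1 ∧ H ≠ FlatVar.top f, if SplitsAt H W then 1 else 0 := by
    rw [← Finset.sum_neg_distrib]
    refine Finset.sum_congr rfl fun H hH => ?_
    simp only [Finset.mem_filter, Finset.mem_univ, true_and] at hH
    exact ih H hH.1 hH.2
  rw [flatGen_eq, hE, Finset.sum_insert (by simp), flatGen_top, sub_mul, add_mul, map_sub, map_add,
    hDeg_X_mul, hDeg_X_mul, Finset.sum_mul, map_sum, key, hsum]
  ring

/-- Substitution of `flatGen` for the variables. -/
def toH (f : Finset E → ℕ) : MvPolynomial (FlatVar f) ℤ →ₐ[ℤ] MvPolynomial (FlatVar f) ℤ :=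
  aeval flatGen

/-- The degree map on the polynomial ring. -/
def polyDeg (f : Finset E → ℕ) : MvPolynomial (FlatVar f) ℤ →ₗ[ℤ] ℤ :=
  hDeg f ∘ₗ (toH f).toLinearMap

omit [Nonempty E] in
theorem polyDeg_apply (p : MvPolynomial (FlatVar f) ℤ) : polyDeg f p = hDeg f (toH f p) := rfl

omit [Nonempty E] in
theorem toH_X (F : FlatVar f) : toH f (X F) = flatGen F := aeval_X _ _

/-- The generator `h_G = ∑_{H ⊇ G} x_H`. -/
def hGen (G : FlatVar f) : MvPolynomial (FlatVar f) ℤ :=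
  ∑ H ∈ Finset.univ.filter (fun H : FlatVar f => G.1 ⊆ H.1), X H

omit [Nonempty E] in
theorem toH_hGen (G : FlatVar f) : toH f (hGen G) = X G := by
  rw [hGen, map_sum, ← sum_flatGen]
  exact Finset.sum_congr rfl fun H _ => toH_X H

/-- The annihilator of the degree map. -/
def degAnn (f : Finset E → ℕ) : Ideal (MvPolynomial (FlatVar f) ℤ) where
  carrier := {p | ∀ q, polyDeg f (p * q) = 0}
  add_mem' := fun {a b} ha hb q => by rw [add_mul, map_add, ha, hb, add_zero]
  zero_mem' := fun q => by rw [zero_mul, map_zero]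
  smul_mem' := fun c p hp q => by rw [smul_eq_mul, mul_comm c, mul_assoc, hp]

omit [Nonempty E] in
theorem mem_degAnn_of_monomial {p : MvPolynomial (FlatVar f) ℤ}
    (h : ∀ W, hDeg f (toH f p * monomial W 1) = 0) : p ∈ degAnn f := by
  intro q
  rw [polyDeg_apply, map_mul]
  induction toH f q using MvPolynomial.induction_on' with
  | monomial W a =>
    rw [← mul_one a, ← smul_eq_mul a 1, ← smul_monomial, mul_smul_comm, map_smul, h, smul_zero]
  | add p q hp hq => rw [mul_add, map_add, hp, hq, add_zero]

omit [Nonempty E] in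
theorem hGen_pow_mem_degAnn {G : FlatVar f} {b : ℕ} (hb : f G.1 ≤ b) :
    hGen G ^ b ∈ degAnn f := by
  refine mem_degAnn_of_monomial fun W => ?_
  rw [map_pow, toH_hGen, X_pow_eq_monomial, monomial_mul, one_mul, hDeg_monomial, hCoeff, if_neg]
  rintro ⟨-, h⟩
  have := h G.1 G.2.2
  simp only [degBelow_add, degBelow_single, subset_refl, if_true] at this
  omega

theorem X_mul_hGen_pow_mem_degAnn (hf : IsLooplessRank f) {F G : FlatVar f} {b : ℕ}
    (hFG : F.1 ⊂ G.1) (hb : f G.1 - f F.1 ≤ b) : X F * hGen G ^ b ∈ degAnn f := by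
  refine mem_degAnn_of_monomial fun W => ?_
  rw [map_mul (toH f), map_pow, toH_X, toH_hGen, X_pow_eq_monomial, mul_assoc, monomial_mul,
    one_mul, hDeg_flatGen_mul hf F (FlatVar.ne_top_of_ssubset hFG), if_neg, neg_zero]
  intro h
  have h1 := h.tight
  have h2 := h.above G hFG
  simp only [degBelow_add, degBelow_single, subset_refl, if_true, hFG.2, if_false] at h1 h2
  have := degBelow_mono hFG.1 W
  omega

theorem SplitsAt.congr_join {F G K : FlatVar f} (hG : ¬ G.1 ⊆ F.1)
    (hK : F.1 ∪ G.1 ⊆ K.1) (hmin : ∀ H : FlatVar f, F.1 ∪ G.1 ⊆ H.1 → K.1 ⊆ H.1)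
    (W : FlatVar f →₀ ℕ) :
    SplitsAt F (Finsupp.single G 1 + W) ↔ SplitsAt F (Finsupp.single K 1 + W) := by
  have hGK : G.1 ⊆ K.1 := Finset.subset_union_right.trans hK
  have hKF : ¬ K.1 ⊆ F.1 := fun h => hG (hGK.trans h)
  have below : ∀ A, A ⊆ F.1 →
      degBelow A (Finsupp.single G 1 + W) = degBelow A (Finsupp.single K 1 + W) := by
    intro A hA
    have h1 : ¬ G.1 ⊆ A := fun h => hG (h.trans hA)
    have h2 : ¬ K.1 ⊆ A := fun h => hKF (h.trans hA)
    simp only [degBelow_add, degBelow_single, h1, h2]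
  have above : ∀ H : FlatVar f, F.1 ⊆ H.1 →
      degBelow H.1 (Finsupp.single G 1 + W) = degBelow H.1 (Finsupp.single K 1 + W) := by
    intro H hH
    have : G.1 ⊆ H.1 ↔ K.1 ⊆ H.1 :=
      ⟨fun h => hmin H (Finset.union_subset hH h), fun h => hGK.trans h⟩
    simp only [degBelow_add, degBelow_single, this]
  have top := above (FlatVar.top f) (Finset.subset_univ _)
  have hF := below F.1 subset_rfl
  constructor
  · intro h
    exact ⟨top ▸ h.total, hF ▸ h.tight, fun A hA hAF => below A hAF ▸ h.below A hA hAF,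
      fun H hH => above H hH.1 ▸ h.above H hH⟩
  · intro h
    exact ⟨top ▸ h.total, hF ▸ h.tight, fun A hA hAF => below A hAF ▸ h.below A hA hAF,
      fun H hH => above H hH.1 ▸ h.above H hH⟩

theorem X_mul_hGen_sub_mem_degAnn (hf : IsLooplessRank f) {F G K : FlatVar f} (hG : ¬ G.1 ⊆ F.1)
    (hK : F.1 ∪ G.1 ⊆ K.1) (hmin : ∀ H : FlatVar f, F.1 ∪ G.1 ⊆ H.1 → K.1 ⊆ H.1) :
    X F * (hGen G - hGen K) ∈ degAnn f := by
  have hFt : F ≠ FlatVar.top f := by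
    rintro rfl
    exact hG (Finset.subset_univ _)
  refine mem_degAnn_of_monomial fun W => ?_
  rw [map_mul (toH f), map_sub, toH_X, toH_hGen, toH_hGen, mul_assoc, sub_mul, mul_sub, map_sub, X,
    X, monomial_mul, monomial_mul, one_mul, hDeg_flatGen_mul hf F hFt,
    hDeg_flatGen_mul hf F hFt, SplitsAt.congr_join hG hK hmin, sub_self]

theorem X_mul_X_mem_degAnn (hf : IsLooplessRank f) {F G : FlatVar f} (hFG : ¬ F.1 ⊆ G.1)
    (hGF : ¬ G.1 ⊆ F.1) : X F * X G ∈ degAnn f := by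
  induction G using FlatVar.downward_induction with
  | _ G ih =>
  obtain ⟨K, hK, -, hmin⟩ := hf.exists_closure (A := F.1 ∪ G.1)
    (F.2.2.mono Finset.subset_union_left)
  have hGK : G.1 ⊆ K.1 := Finset.subset_union_right.trans hK
  have hFK : F.1 ⊆ K.1 := Finset.subset_union_left.trans hK
  have key := X_mul_hGen_sub_mem_degAnn hf hGF hK hmin
  have hsplit : hGen G - hGen K = X G +
      ∑ H : FlatVar f with G.1 ⊂ H.1 ∧ ¬ F.1 ⊆ H.1, X H := by
    have h1 : (Finset.univ.filter fun H : FlatVar f => K.1 ⊆ H.1) =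
        (Finset.univ.filter fun H : FlatVar f => G.1 ⊂ H.1).filter fun H => F.1 ⊆ H.1 := by
      ext H
      simp only [Finset.mem_filter, Finset.mem_univ, true_and]
      refine ⟨fun h => ⟨⟨hGK.trans h, fun h' => hFG ?_⟩, hFK.trans h⟩,
        fun h => hmin H (Finset.union_subset h.2 h.1.1)⟩
      exact hFK.trans (h.trans h')
    rw [hGen, hGen, sum_superset, h1,
      ← Finset.sum_filter_add_sum_filter_not (Finset.univ.filter fun H : FlatVar f => G.1 ⊂ H.1)
        (fun H => F.1 ⊆ H.1), Finset.filter_filter (fun H : FlatVar f => G.1 ⊂ H.1)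
        (fun H : FlatVar f => ¬ F.1 ⊆ H.1)]
    ring
  rw [hsplit, mul_add, Finset.mul_sum] at key
  refine (Ideal.add_mem_iff_left _ (Ideal.sum_mem _ fun H hH => ?_)).1 key
  simp only [Finset.mem_filter, Finset.mem_univ, true_and] at hH
  exact ih H hH.1 hH.2 fun h => hGF (hH.1.1.trans h)

omit [Fintype E] [Nonempty E] in
theorem exists_max_of_chain {S : Finset (FlatVar f)} (hS : S.Nonempty)
    (hc : ∀ F ∈ S, ∀ G ∈ S, F.1 ⊆ G.1 ∨ G.1 ⊆ F.1) : ∃ F ∈ S, ∀ G ∈ S, G.1 ⊆ F.1 := by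
  obtain ⟨F, hF, hmax⟩ := Finset.exists_max_image S (fun F => F.1.card) hS
  refine ⟨F, hF, fun G hG => ?_⟩
  rcases hc F hF G hG with h | h
  · exact (Finset.eq_of_subset_of_card_le h (hmax G hG)).ge
  · exact h

theorem span_DPrels_le_degAnn (hf : IsLooplessRank f) : Ideal.span (DPrels f) ≤ degAnn f := by
  rw [Ideal.span_le]
  rintro p ⟨G, S, b, hb, rfl⟩
  change (∏ G' ∈ S, X G') * hGen G ^ b ∈ degAnn f
  set S' := S.filter fun G' => G'.1 ⊂ G.1 with hS'
  by_cases hc : ∀ F ∈ S', ∀ H ∈ S', F.1 ⊆ H.1 ∨ H.1 ⊆ F.1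
  · rcases S'.eq_empty_or_nonempty with h0 | h0
    · rw [h0] at hb
      simp only [Finset.sup_empty, Finset.bot_eq_empty, hf.empty, Nat.sub_zero] at hb
      exact Ideal.mul_mem_left _ _ (hGen_pow_mem_degAnn hb)
    · obtain ⟨F, hF, hmax⟩ := exists_max_of_chain h0 hc
      have hsup : S'.sup (fun G' => G'.1) = F.1 :=
        le_antisymm (Finset.sup_le hmax) (Finset.le_sup (f := fun G' : FlatVar f => G'.1) hF)
      rw [hsup] at hb
      have hF' := Finset.mem_filter.1 hF
      rw [← Finset.mul_prod_erase S _ hF'.1, mul_right_comm]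
      exact Ideal.mul_mem_right _ _ (X_mul_hGen_pow_mem_degAnn hf hF'.2 hb)
  · push Not at hc
    obtain ⟨F, hF, H, hH, h1, h2⟩ := hc
    have hF' := (Finset.mem_filter.1 hF).1
    have hH' := (Finset.mem_filter.1 hH).1
    have hne : H ≠ F := by
      rintro rfl
      exact h1 subset_rfl
    rw [← Finset.mul_prod_erase S _ hF', ← Finset.mul_prod_erase (S.erase F) _
      (Finset.mem_erase.2 ⟨hne, hH'⟩), ← mul_assoc, mul_assoc]
    exact Ideal.mul_mem_right _ _ (X_mul_X_mem_degAnn hf h1 h2)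

/-- The degree of the exponent `W` in the flats not contained in `A`. -/
def degOutside (A : Finset E) (W : FlatVar f →₀ ℕ) : ℕ :=
  ∑ G : FlatVar f with ¬ G.1 ⊆ A, W G

omit [Nonempty E] in
theorem degOutside_add (A : Finset E) (W W' : FlatVar f →₀ ℕ) :
    degOutside A (W + W') = degOutside A W + degOutside A W' := by
  simp [degOutside, Finset.sum_add_distrib]

omit [Nonempty E] in
theorem degOutside_single (A : Finset E) (G : FlatVar f) (b : ℕ) :
    degOutside A (Finsupp.single G b) = if G.1 ⊆ A then 0 else b := by
  simp [degOutside, Finsupp.single_apply, Finset.sum_ite_eq]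

omit [Nonempty E] in
theorem degBelow_add_degOutside (A : Finset E) (W : FlatVar f →₀ ℕ) :
    degBelow A W + degOutside A W = W.degree := by
  rw [degBelow, degOutside, Finset.sum_filter_add_sum_filter_not, Finsupp.degree_eq_sum]

/-- The polynomials of degree at least `n` in the flats not contained in `A`. -/
def outsideSub (A : Finset E) (n : ℕ) : Submodule ℤ (MvPolynomial (FlatVar f) ℤ) :=
  restrictSupport ℤ {W | n ≤ degOutside A W}

omit [Nonempty E] in
theorem monomial_mem_outsideSub (A : Finset E) (W : FlatVar f →₀ ℕ) :
    monomial W 1 ∈ outsideSub A (degOutside A W) := by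
  rw [outsideSub, mem_restrictSupport_iff]
  intro s hs
  rw [Finset.mem_coe, support_monomial, if_neg one_ne_zero, Finset.mem_singleton] at hs
  rw [hs, Set.mem_ofPred_eq]

omit [Nonempty E] in
theorem mul_mem_outsideSub {A : Finset E} {m n : ℕ} {p q : MvPolynomial (FlatVar f) ℤ}
    (hp : p ∈ outsideSub A m) (hq : q ∈ outsideSub A n) : p * q ∈ outsideSub A (m + n) := by
  rw [outsideSub, mem_restrictSupport_iff] at *
  intro s hs
  obtain ⟨a, ha, b, hb, rfl⟩ := Finset.mem_add.1 (support_mul p q hs)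
  rw [Set.mem_ofPred_eq, degOutside_add]
  exact add_le_add (hp ha) (hq hb)

omit [Nonempty E] in
theorem flatGen_mem_outsideSub {A : Finset E} (G : FlatVar f) :
    flatGen G ∈ outsideSub A (degOutside A (Finsupp.single G 1)) := by
  induction G using FlatVar.downward_induction with
  | _ G ih =>
  rw [flatGen_eq]
  refine Submodule.sub_mem _ (monomial_mem_outsideSub A _) (Submodule.sum_mem _ fun H hH => ?_)
  simp only [Finset.mem_filter, Finset.mem_univ, true_and] at hH
  have h := ih H hH
  rw [outsideSub, mem_restrictSupport_iff] at *
  refine h.trans fun s (hs : _ ≤ degOutside A s) => (le_trans ?_ hs : _ ≤ degOutside A s)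
  simp only [degOutside_single]
  by_cases hHA : H.1 ⊆ A
  · simp [hHA, hH.1.trans hHA]
  · simp only [hHA, if_false]
    split_ifs <;> simp

omit [Nonempty E] in
theorem toH_monomial_mem_outsideSub (A : Finset E) (W : FlatVar f →₀ ℕ) :
    toH f (monomial W 1) ∈ outsideSub A (degOutside A W) := by
  induction W using Finsupp.induction_linear with
  | zero => simpa using monomial_mem_outsideSub (f := f) A 0
  | add V W hV hW =>
    rw [← one_mul (1 : ℤ), ← monomial_mul, map_mul, degOutside_add]
    exact mul_mem_outsideSub hV hW
  | single G b =>
    induction b with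
    | zero => simpa using monomial_mem_outsideSub (f := f) A 0
    | succ b ih =>
      rw [Finsupp.single_add, degOutside_add, ← one_mul (1 : ℤ), ← monomial_mul, map_mul]
      refine mul_mem_outsideSub ih ?_
      rw [← X, toH_X]
      exact flatGen_mem_outsideSub G

theorem hDeg_flatGen_mul_eq_zero (hf : IsLooplessRank f) {F : FlatVar f}
    (hF : F ≠ FlatVar.top f) {n : ℕ} (hn : f Finset.univ ≤ n + f F.1)
    {p : MvPolynomial (FlatVar f) ℤ} (hp : p ∈ outsideSub F.1 n) :
    hDeg f (flatGen F * p) = 0 := by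
  rw [outsideSub, mem_restrictSupport_iff] at hp
  rw [p.as_sum, Finset.mul_sum, map_sum]
  refine Finset.sum_eq_zero fun W hW => ?_
  rw [← mul_one (coeff W p), ← smul_eq_mul (coeff W p) 1, ← smul_monomial, mul_smul_comm, map_smul,
    hDeg_flatGen_mul hf F hF, if_neg, neg_zero, smul_zero]
  intro h
  have h1 := h.tight
  have h2 := h.total
  have h3 := degBelow_add_degOutside F.1 W
  rw [degBelow_univ] at h2
  have h4 : n ≤ degOutside F.1 W := hp hW
  omega

theorem degOutside_le_of_polyDeg_ne_zero (hf : IsLooplessRank f) {F : FlatVar f}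
    (hF : F ≠ FlatVar.top f) {W : FlatVar f →₀ ℕ} (hWF : W F ≠ 0)
    (h : polyDeg f (monomial W 1) ≠ 0) : degOutside F.1 W + f F.1 + 1 ≤ f Finset.univ := by
  by_contra hlt
  refine h ?_
  obtain ⟨V, rfl⟩ : ∃ V, W = Finsupp.single F 1 + V :=
    ⟨W - Finsupp.single F 1, (add_tsub_cancel_of_le
      (Finsupp.single_le_iff.2 (Nat.one_le_iff_ne_zero.2 hWF))).symm⟩
  rw [degOutside_add, degOutside_single, if_pos subset_rfl] at hlt
  rw [polyDeg_apply, ← one_mul (1 : ℤ), ← monomial_mul, map_mul, ← X, toH_X]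
  exact hDeg_flatGen_mul_eq_zero hf hF (by omega) (toH_monomial_mem_outsideSub F.1 V)

/-- Any two members are comparable. -/
def FlatChain (C : Finset (FlatVar f)) : Prop :=
  ∀ F ∈ C, ∀ G ∈ C, F.1 ⊆ G.1 ∨ G.1 ⊆ F.1

/-- The rank jump at `F` over the members of `C` properly contained in `F`. -/
def gap (C : Finset (FlatVar f)) (F : FlatVar f) : ℕ :=
  f F.1 - f ((C.filter fun G => G.1 ⊂ F.1).sup fun G => G.1)

/-- The exponent with the rank jumps of `C` as entries. -/
def gapExp (C : Finset (FlatVar f)) : FlatVar f →₀ ℕ :=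
  ∑ F ∈ C, Finsupp.single F (gap C F)

omit [Fintype E] [Nonempty E] in
theorem FlatChain.mono {C D : Finset (FlatVar f)} (hC : FlatChain C) (h : D ⊆ C) : FlatChain D :=
  fun F hF G hG => hC F (h hF) G (h hG)

omit [Fintype E] [Nonempty E] in
theorem FlatChain.induction {P : (C : Finset (FlatVar f)) → FlatChain C → Prop}
    (empty : ∀ h, P ∅ h)
    (insert : ∀ F C, (∀ G ∈ C, G.1 ⊂ F.1) → ∀ (hC : FlatChain C) (hC' : FlatChain (insert F C)),
      P C hC → P (insert F C) hC')
    {C : Finset (FlatVar f)} (hC : FlatChain C) : P C hC := by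
  induction hn : C.card generalizing C with
  | zero =>
    obtain rfl := Finset.card_eq_zero.1 hn
    exact empty hC
  | succ n ih =>
    obtain ⟨F, hF, hmax⟩ := exists_max_of_chain (Finset.card_pos.1 (by omega)) hC
    obtain ⟨D, hFD, rfl⟩ : ∃ D, F ∉ D ∧ C = Insert.insert F D :=
      ⟨C.erase F, Finset.notMem_erase F C, (Finset.insert_erase hF).symm⟩
    have hD : FlatChain D := hC.mono (Finset.subset_insert _ _)
    refine insert F D (fun G hG => ?_) hD hC (ih hD ?_)
    · refine FlatVar.ssubset_of_subset_of_ne (hmax G (Finset.mem_insert_of_mem hG)) ?_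
      rintro rfl
      exact hFD hG
    · rw [Finset.card_insert_of_notMem hFD] at hn
      omega

omit [Fintype E] [Nonempty E] in
theorem FlatChain.rank_sup_lt (hf : IsLooplessRank f) {C : Finset (FlatVar f)} (hC : FlatChain C)
    {A : Finset E} (hA : A.Nonempty) (h : ∀ G ∈ C, G.1 ⊂ A) :
    f (C.sup fun G => G.1) < f A := by
  rcases C.eq_empty_or_nonempty with rfl | h0
  · simpa [hf.empty] using hf.pos A hA
  · obtain ⟨F, hF, hmax⟩ := exists_max_of_chain h0 hC
    rw [le_antisymm (Finset.sup_le hmax) (Finset.le_sup (f := fun G' : FlatVar f => G'.1) hF)]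
    exact hf.lt_of_ssubset (h F hF)

omit [Fintype E] [Nonempty E] in
theorem FlatChain.gap_pos (hf : IsLooplessRank f) {C : Finset (FlatVar f)} (hC : FlatChain C)
    (F : FlatVar f) : 0 < gap C F :=
  Nat.sub_pos_of_lt <| (hC.mono (Finset.filter_subset _ _)).rank_sup_lt hf F.2.2 fun _ hG =>
    (Finset.mem_filter.1 hG).2

omit [Fintype E] [Nonempty E] in
theorem gapExp_apply (C : Finset (FlatVar f)) (F : FlatVar f) :
    gapExp C F = if F ∈ C then gap C F else 0 := by
  simp [gapExp, Finsupp.finsetSum_apply, Finsupp.single_apply]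

omit [Fintype E] [Nonempty E] in
theorem gap_insert_self {C : Finset (FlatVar f)} {F : FlatVar f} (h : ∀ G ∈ C, G.1 ⊂ F.1) :
    gap (insert F C) F = f F.1 - f (C.sup fun G => G.1) := by
  rw [gap, Finset.filter_insert, if_neg (fun h => h.2 subset_rfl), Finset.filter_true_of_mem h]

omit [Fintype E] [Nonempty E] in
theorem gapExp_insert {C : Finset (FlatVar f)} {F : FlatVar f} (h : ∀ G ∈ C, G.1 ⊂ F.1) :
    gapExp (insert F C) =
      Finsupp.single F (f F.1 - f (C.sup fun G => G.1)) + gapExp C := by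
  rw [gapExp, Finset.sum_insert fun hF => (h F hF).2 subset_rfl, gap_insert_self h, gapExp]
  congr 1
  refine Finset.sum_congr rfl fun G hG => ?_
  rw [gap, gap, Finset.filter_insert, if_neg fun h' => h'.2 (h G hG).1]

omit [Fintype E] [Nonempty E] in
theorem sup_insert_eq {C : Finset (FlatVar f)} {F : FlatVar f} (h : ∀ G ∈ C, G.1 ⊂ F.1) :
    ((insert F C).sup fun G => G.1) = F.1 := by
  rw [Finset.sup_insert]
  exact sup_eq_left.2 (Finset.sup_le fun G hG => (h G hG).1)

omit [Nonempty E] in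
theorem FlatChain.degBelow_gapExp (hf : IsLooplessRank f) {C : Finset (FlatVar f)}
    (hC : FlatChain C) {A : Finset E} (hA : ∀ G ∈ C, G.1 ⊆ A) :
    degBelow A (gapExp C) = f (C.sup fun G => G.1) := by
  induction hC using FlatChain.induction with
  | empty _ => simp [gapExp, hf.empty]
  | insert F C h _ _ ih =>
    rw [gapExp_insert h, degBelow_add, degBelow_single, if_pos (hA F (Finset.mem_insert_self _ _)),
      ih fun G hG => hA G (Finset.mem_insert_of_mem hG), sup_insert_eq h]
    exact Nat.sub_add_cancel (hf.mono _ _ (Finset.sup_le fun G hG => (h G hG).1))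

omit [Nonempty E] in
theorem FlatChain.degBelow_gapExp_of_mem (hf : IsLooplessRank f) {C : Finset (FlatVar f)}
    (hC : FlatChain C) {F : FlatVar f} (hF : F ∈ C) : degBelow F.1 (gapExp C) = f F.1 := by
  induction hC using FlatChain.induction with
  | empty _ => simp at hF
  | insert G C h _ hC' ih =>
    rcases Finset.mem_insert.1 hF with rfl | hFC
    · rw [hC'.degBelow_gapExp hf, sup_insert_eq h]
      intro H hH
      rcases Finset.mem_insert.1 hH with rfl | hH
      · exact subset_rfl
      · exact (h H hH).1
    · rw [gapExp_insert h, degBelow_add, ih hFC, degBelow_single, if_neg (h F hFC).2, zero_add]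

omit [Fintype E] [Nonempty E] in
theorem gapExp_prod_dvd (hf : IsLooplessRank f) {C : Finset (FlatVar f)} (hC : FlatChain C) :
    ∏ G ∈ C, X G ∣ monomial (gapExp C) (1 : ℤ) := by
  rw [gapExp, monomial_sum_one]
  refine Finset.prod_dvd_prod_of_dvd _ _ fun G _ => ?_
  rw [← X_pow_eq_monomial]
  exact dvd_pow_self _ (hC.gap_pos hf G).ne'

omit [Nonempty E] in
theorem prod_mul_hGen_pow_mem {G : FlatVar f} {S : Finset (FlatVar f)} {b : ℕ}
    (hb : gap S G ≤ b) : (∏ G' ∈ S, X G') * hGen G ^ b ∈ Ideal.span (DPrels f) :=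
  Ideal.subset_span ⟨G, S, b, hb, rfl⟩

theorem hGen_top : hGen (FlatVar.top f) = X (FlatVar.top f) := by
  rw [hGen, sum_superset, Finset.sum_eq_zero, add_zero]
  intro H hH
  simp only [Finset.mem_filter, Finset.mem_univ, true_and] at hH
  exact absurd rfl (FlatVar.ne_top_of_ssubset hH)

theorem X_mul_top_pow_mem {F : FlatVar f} (hF : F ≠ FlatVar.top f) {n : ℕ}
    (hn : f Finset.univ ≤ n + f F.1) :
    X F * X (FlatVar.top f) ^ n ∈ Ideal.span (DPrels f) := by
  have := prod_mul_hGen_pow_mem (G := FlatVar.top f) (S := {F}) (b := n) (by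
    have : F.1 ⊂ (FlatVar.top f).1 := FlatVar.ssubset_top hF
    rw [gap, Finset.filter_singleton, if_pos this, Finset.sup_singleton]
    exact Nat.sub_le_iff_le_add.2 hn)
  rwa [Finset.prod_singleton, hGen_top] at this

theorem mul_add_pow_eq {R : Type*} [CommRing R] {x t y : R} {n : ℕ} (ht : t * y ^ n = 0)
    (hx : x * y ^ (n + 1) = 0) (d : ℕ) :
    y ^ n * (x + t + y) ^ (d + 1) = y ^ n * (x ^ (d + 1) + y ^ (d + 1)) := by
  induction d with
  | zero => linear_combination ht
  | succ d ih =>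
    rw [pow_succ, ← mul_assoc, ih]
    linear_combination (x ^ (d + 1) + y ^ (d + 1)) * ht + (x ^ d + y ^ d) * hx

theorem FlatChain.mk_gapExp (hf : IsLooplessRank f) {C : Finset (FlatVar f)}
    (hC : FlatChain C) (htop : FlatVar.top f ∉ C) :
    Ideal.Quotient.mk (Ideal.span (DPrels f)) (monomial (gapExp C) 1 *
      X (FlatVar.top f) ^ (f Finset.univ - 1 - f (C.sup fun G => G.1))) =
    (-1) ^ C.card * Ideal.Quotient.mk (Ideal.span (DPrels f))
      (X (FlatVar.top f) ^ (f Finset.univ - 1)) := by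
  induction hC using FlatChain.induction with
  | empty _ => simp [gapExp, hf.empty]
  | insert F C h hC hC' ih =>
    have hFt : F ≠ FlatVar.top f := by
      rintro rfl
      exact htop (Finset.mem_insert_self _ _)
    have hFr := hf.lt_of_ssubset (FlatVar.ssubset_top hFt)
    have hCF := hC.rank_sup_lt hf F.2.2 h
    specialize ih fun hm => htop (Finset.mem_insert_of_mem hm)
    rw [Finset.card_insert_of_notMem fun hF => (h F hF).2 subset_rfl, gapExp_insert h,
      sup_insert_eq h]
    obtain ⟨d, hd⟩ : ∃ d, f F.1 - f (C.sup fun G => G.1) = d + 1 :=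
      ⟨_, (Nat.succ_pred (by omega)).symm⟩
    obtain ⟨n, hn⟩ : ∃ n, f Finset.univ - 1 - f F.1 = n := ⟨_, rfl⟩
    have hnd : f Finset.univ - 1 - f (C.sup fun G => G.1) = n + (d + 1) := by omega
    rw [hnd] at ih
    rw [hd, hn, ← one_mul (1 : ℤ), ← monomial_mul, ← X_pow_eq_monomial]
    have hrel : monomial (gapExp C) (1 : ℤ) * hGen F ^ (d + 1) ∈ Ideal.span (DPrels f) := by
      refine Ideal.mem_of_dvd _ (mul_dvd_mul_right (gapExp_prod_dvd hf hC) _)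
        (prod_mul_hGen_pow_mem ?_)
      rw [gap, Finset.filter_true_of_mem h, hd]
    have hgen : hGen F = X F + (∑ H : FlatVar f with F.1 ⊂ H.1 ∧ H ≠ FlatVar.top f, X H) +
        X (FlatVar.top f) := by
      have : (Finset.univ.filter fun H : FlatVar f => F.1 ⊂ H.1) =
          insert (FlatVar.top f) (Finset.univ.filter fun H : FlatVar f =>
            F.1 ⊂ H.1 ∧ H ≠ FlatVar.top f) := by
        ext H
        by_cases h : H = FlatVar.top f
        · simp [h, FlatVar.ssubset_top hFt]
        · simp [h]
      rw [hGen, sum_superset, this, Finset.sum_insert (by simp)]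
      ring
    have ht : (∑ H : FlatVar f with F.1 ⊂ H.1 ∧ H ≠ FlatVar.top f, X H) *
        X (FlatVar.top f) ^ n ∈ Ideal.span (DPrels f) := by
      rw [Finset.sum_mul]
      refine Ideal.sum_mem _ fun H hH => ?_
      simp only [Finset.mem_filter, Finset.mem_univ, true_and] at hH
      have := hf.lt_of_ssubset hH.1
      exact X_mul_top_pow_mem hH.2 (by omega)
    have hx : X F * X (FlatVar.top f) ^ (n + 1) ∈ Ideal.span (DPrels f) :=
      X_mul_top_pow_mem hFt (by omega)
    rw [hgen] at hrel
    rw [← Ideal.Quotient.eq_zero_iff_mem] at hrel ht hx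
    simp only [map_mul, map_pow, map_add] at hrel ht hx ih ⊢
    have key := mul_add_pow_eq ht hx d
    linear_combination
      (- Ideal.Quotient.mk (Ideal.span (DPrels f)) (monomial (gapExp C) (1 : ℤ))) * key +
      (Ideal.Quotient.mk (Ideal.span (DPrels f)) (X (FlatVar.top f))) ^ n * hrel - ih

/-- A potential on exponents, decreasing when a flat is replaced by a larger one. -/
def potential (W : FlatVar f →₀ ℕ) : ℕ := ∑ G : FlatVar f, degBelow G.1 W

omit [Nonempty E] in
theorem potential_add (W W' : FlatVar f →₀ ℕ) :
    potential (W + W') = potential W + potential W' := by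
  simp [potential, Finset.sum_add_distrib]

omit [Nonempty E] in
theorem potential_single_lt {F H : FlatVar f} (h : F.1 ⊂ H.1) :
    potential (Finsupp.single H 1) < potential (Finsupp.single F 1) := by
  refine Finset.sum_lt_sum (fun G _ => ?_) ⟨F, Finset.mem_univ _, ?_⟩
  · simp only [degBelow_single]
    by_cases hG : H.1 ⊆ G.1
    · simp [hG, h.1.trans hG]
    · simp [hG]
  · simp [degBelow_single, h.2]

/-- The polynomials of degree `k` all of whose monomials have potential less than `μ`. -/
def lowSub (f : Finset E → ℕ) (k μ : ℕ) : Submodule ℤ (MvPolynomial (FlatVar f) ℤ) :=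
  restrictSupport ℤ {W | W.degree = k ∧ potential W < μ}

omit [Nonempty E] in
theorem mul_mem_lowSub {k l μ ν : ℕ} {p q : MvPolynomial (FlatVar f) ℤ}
    (hp : p ∈ lowSub f k μ) (hq : q ∈ lowSub f l (ν + 1)) : p * q ∈ lowSub f (k + l) (μ + ν) := by
  rw [lowSub, mem_restrictSupport_iff] at *
  intro s hs
  obtain ⟨a, ha, b, hb, rfl⟩ := Finset.mem_add.1 (support_mul p q hs)
  obtain ⟨ha1, ha2⟩ := hp ha
  obtain ⟨hb1, hb2⟩ := hq hb
  rw [Set.mem_ofPred_eq, map_add, potential_add]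
  omega

/-- The polynomial `p` is the monomial `m` plus monomials of the same degree and lower potential. -/
def HasLead (p : MvPolynomial (FlatVar f) ℤ) (m : FlatVar f →₀ ℕ) : Prop :=
  p - monomial m 1 ∈ lowSub f m.degree (potential m)

omit [Nonempty E] in
theorem hasLead_monomial (m : FlatVar f →₀ ℕ) : HasLead (monomial m 1) m := by
  rw [HasLead, sub_self]
  exact Submodule.zero_mem _

omit [Nonempty E] in
theorem HasLead.mul {p q : MvPolynomial (FlatVar f) ℤ} {m n : FlatVar f →₀ ℕ} (hp : HasLead p m)
    (hq : HasLead q n) : HasLead (p * q) (m + n) := by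
  have hm : ∀ m : FlatVar f →₀ ℕ, monomial m (1 : ℤ) ∈ lowSub f m.degree (potential m + 1) :=
    fun m => (monomial_mem_restrictSupport ℤ).2 (Or.inl ⟨rfl, Nat.lt_succ_self _⟩)
  have hq' : q ∈ lowSub f n.degree (potential n + 1) := by
    rw [← sub_add_cancel q (monomial n 1)]
    have hle : lowSub f n.degree (potential n) ≤ lowSub f n.degree (potential n + 1) :=
      restrictSupport_mono ℤ fun s hs => ⟨hs.1, hs.2.trans (Nat.lt_succ_self _)⟩
    exact Submodule.add_mem _ (hle hq) (hm n)
  have h1 := mul_mem_lowSub hp hq'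
  have h2 := mul_mem_lowSub hq (hm m)
  rw [add_comm n.degree, add_comm (potential n)] at h2
  have : p * q - monomial (m + n) 1 =
      (p - monomial m 1) * q + (q - monomial n 1) * monomial m 1 := by
    have h : monomial (m + n) (1 : ℤ) = monomial m 1 * monomial n 1 := by
      rw [monomial_mul, one_mul]
    rw [h]
    ring
  rw [HasLead, this, map_add, potential_add]
  exact Submodule.add_mem _ h1 h2

omit [Nonempty E] in
theorem hasLead_hGen_pow (F : FlatVar f) (b : ℕ) : HasLead (hGen F ^ b) (Finsupp.single F b) := by
  induction b with
  | zero => simpa using hasLead_monomial (f := f) 0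
  | succ b ih =>
    rw [pow_succ, Finsupp.single_add]
    refine ih.mul ?_
    rw [HasLead, hGen, sum_superset, X, add_sub_cancel_left]
    refine Submodule.sum_mem _ fun H hH => (monomial_mem_restrictSupport ℤ).2 (Or.inl ?_)
    simp only [Finset.mem_filter, Finset.mem_univ, true_and] at hH
    exact ⟨by simp only [Finsupp.degree_single], potential_single_lt hH⟩

/-- The exponents of the monomial basis. -/
def Standard (m : FlatVar f →₀ ℕ) : Prop :=
  FlatChain m.support ∧ ∀ F ∈ m.support, m F < gap m.support F

/-- The residue class map as a `ℤ`-linear map. -/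
def mkLin (f : Finset E → ℕ) : MvPolynomial (FlatVar f) ℤ →ₗ[ℤ]
    MvPolynomial (FlatVar f) ℤ ⧸ Ideal.span (DPrels f) :=
  (Ideal.Quotient.mkₐ ℤ (Ideal.span (DPrels f))).toLinearMap

omit [Nonempty E] in
theorem mkLin_apply (p : MvPolynomial (FlatVar f) ℤ) :
    mkLin f p = Ideal.Quotient.mk (Ideal.span (DPrels f)) p := rfl

/-- The polynomials of degree `k` in the standard monomials. -/
def standardSub (f : Finset E → ℕ) (k : ℕ) : Submodule ℤ (MvPolynomial (FlatVar f) ℤ) :=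
  restrictSupport ℤ {s | Standard s ∧ s.degree = k}

omit [Nonempty E] in
theorem X_mul_X_mem (hf : IsLooplessRank f) {F G : FlatVar f} (hFG : ¬ F.1 ⊆ G.1)
    (hGF : ¬ G.1 ⊆ F.1) : X F * X G ∈ Ideal.span (DPrels f) := by
  obtain ⟨K, hK, hfK, -⟩ := hf.exists_closure (A := F.1 ∪ G.1)
    (F.2.2.mono Finset.subset_union_left)
  have hF : F.1 ⊆ K.1 := Finset.subset_union_left.trans hK
  have hG : G.1 ⊆ K.1 := Finset.subset_union_right.trans hK
  have hne : F ≠ G := by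
    rintro rfl
    exact hFG subset_rfl
  have := prod_mul_hGen_pow_mem (G := K) (S := {F, G}) (b := 0) (by
    rw [gap, Finset.filter_true_of_mem, Finset.sup_insert, Finset.sup_singleton, hfK]
    · exact (Nat.sub_self _).le
    · intro H hH
      rcases Finset.mem_insert.1 hH with rfl | hH
      · exact ⟨hF, fun h => hGF (hG.trans h)⟩
      · obtain rfl := Finset.mem_singleton.1 hH
        exact ⟨hG, fun h => hFG (hF.trans h)⟩)
  rwa [pow_zero, mul_one, Finset.prod_pair hne] at this

omit [Nonempty E] in
theorem exists_mem_hasLead (hf : IsLooplessRank f) {m : FlatVar f →₀ ℕ} (hm : ¬ Standard m) :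
    ∃ p ∈ Ideal.span (DPrels f), HasLead p m := by
  by_cases hc : FlatChain m.support
  · have : ∃ F ∈ m.support, gap m.support F ≤ m F := by
      by_contra! h
      exact hm ⟨hc, h⟩
    obtain ⟨F, hF, hgap⟩ := this
    set S := m.support.filter fun G => G.1 ⊂ F.1 with hS
    set b := gap m.support F with hb
    have hprod : ∏ G ∈ S, X G = monomial (∑ G ∈ S, Finsupp.single G 1) (1 : ℤ) := by
      rw [monomial_sum_one]
      rfl
    have hle : ∑ G ∈ S, Finsupp.single G 1 + Finsupp.single F b ≤ m := by
      intro G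
      rw [Finsupp.add_apply, Finsupp.finsetSum_apply]
      simp only [Finsupp.single_apply, Finset.sum_ite_eq']
      by_cases hG : G ∈ S
      · have hG' := Finset.mem_filter.1 hG
        have : F ≠ G := by
          rintro rfl
          exact hG'.2.2 subset_rfl
        rw [if_pos hG, if_neg this]
        exact Nat.one_le_iff_ne_zero.2 (Finsupp.mem_support_iff.1 hG'.1)
      · rw [if_neg hG, zero_add]
        split_ifs with h
        · exact h ▸ hgap
        · exact Nat.zero_le _
    have hrel := prod_mul_hGen_pow_mem (G := F) (S := S) (b := b) (by
      rw [hb, gap, gap, hS, Finset.filter_filter]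
      simp)
    rw [hprod] at hrel
    have hlead := ((hasLead_monomial (∑ G ∈ S, Finsupp.single G 1)).mul (hasLead_hGen_pow F b)).mul
      (hasLead_monomial (m - (∑ G ∈ S, Finsupp.single G 1 + Finsupp.single F b)))
    rw [add_tsub_cancel_of_le hle] at hlead
    exact ⟨_, Ideal.mul_mem_right _ _ hrel, hlead⟩
  · simp only [FlatChain, not_forall, not_or] at hc
    obtain ⟨F, hF, G, hG, hFG, hGF⟩ := hc
    have hne : F ≠ G := by
      rintro rfl
      exact hFG subset_rfl
    have hle : Finsupp.single F 1 + Finsupp.single G 1 ≤ m := by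
      intro H
      rw [Finsupp.add_apply, Finsupp.single_apply, Finsupp.single_apply]
      rw [Finsupp.mem_support_iff] at hF hG
      split_ifs with h1 h2 h2
      · exact absurd (h1.trans h2.symm) hne
      · subst h1
        omega
      · subst h2
        omega
      · omega
    refine ⟨monomial m 1, Ideal.mem_of_dvd _ ?_ (X_mul_X_mem hf hFG hGF), hasLead_monomial m⟩
    rw [X, X, monomial_mul, one_mul, monomial_dvd_monomial]
    exact ⟨Or.inr hle, dvd_rfl⟩

omit [Nonempty E] in
theorem mkLin_monomial_mem (hf : IsLooplessRank f) (m : FlatVar f →₀ ℕ) :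
    mkLin f (monomial m 1) ∈ (standardSub f m.degree).map (mkLin f) := by
  induction hn : potential m using Nat.strong_induction_on generalizing m with
  | _ n ih =>
  by_cases hm : Standard m
  · exact Submodule.mem_map_of_mem ((monomial_mem_restrictSupport ℤ).2 (Or.inl ⟨hm, rfl⟩))
  obtain ⟨p, hp, hlead⟩ := exists_mem_hasLead hf hm
  have hp0 : mkLin f p = 0 := Ideal.Quotient.eq_zero_iff_mem.2 hp
  have : mkLin f (monomial m 1) = - mkLin f (p - monomial m 1) := by
    rw [map_sub, hp0, zero_sub, neg_neg]
  rw [this, Submodule.neg_mem_iff]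
  rw [HasLead, lowSub, mem_restrictSupport_iff] at hlead
  generalize p - monomial m 1 = q at hlead
  rw [q.as_sum, map_sum]
  refine Submodule.sum_mem _ fun s hs => ?_
  obtain ⟨h1, h2⟩ := hlead hs
  rw [← mul_one (coeff s q), ← smul_eq_mul (coeff s q) 1, ← smul_monomial, map_smul, ← h1]
  exact Submodule.smul_mem _ _ (ih _ (hn ▸ h2) s rfl)

omit [Nonempty E] in
theorem exists_standard_of_mem_DPgrade (hf : IsLooplessRank f) {k : ℕ}
    {a : MvPolynomial (FlatVar f) ℤ ⧸ Ideal.span (DPrels f)} (ha : a ∈ DPgrade f k) :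
    ∃ p ∈ standardSub f k, mkLin f p = a := by
  have hle : DPgrade f k ≤ (standardSub f k).map (mkLin f) := by
    rw [DPgrade, Submodule.span_le]
    rintro _ ⟨p, hp, rfl⟩
    rw [← mkLin_apply, p.as_sum, map_sum]
    refine Submodule.sum_mem _ fun s hs => ?_
    have hsk : s.degree = k := by
      by_contra h
      exact mem_support_iff.1 hs (IsHomogeneous.coeff_eq_zero hp h)
    rw [← mul_one (coeff s p), ← smul_eq_mul (coeff s p) 1, ← smul_monomial, map_smul, ← hsk]
    exact Submodule.smul_mem _ _ (mkLin_monomial_mem hf s)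
  exact hle ha

/-- The exponent of top degree attached to a chain of proper flats. -/
def fullExp (C : Finset (FlatVar f)) : FlatVar f →₀ ℕ :=
  gapExp C + Finsupp.single (FlatVar.top f) (f Finset.univ - 1 - f (C.sup fun G => G.1))

theorem FlatChain.degree_fullExp (hf : IsLooplessRank f) {C : Finset (FlatVar f)}
    (hC : FlatChain C) (htop : FlatVar.top f ∉ C) : (fullExp C).degree = f Finset.univ - 1 := by
  have := hC.rank_sup_lt hf Finset.univ_nonempty fun G hG => FlatVar.ssubset_top fun h =>
    htop (h ▸ hG)
  rw [← degBelow_univ, fullExp, degBelow_add, hC.degBelow_gapExp hf fun _ _ => Finset.subset_univ _,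
    degBelow_single, if_pos (Finset.subset_univ _)]
  omega

theorem FlatChain.degBelow_fullExp (hf : IsLooplessRank f) {C : Finset (FlatVar f)}
    (hC : FlatChain C) {F : FlatVar f} (hF : F ∈ C) (hFt : F ≠ FlatVar.top f) :
    degBelow F.1 (fullExp C) = f F.1 := by
  have h : ¬ (FlatVar.top f).1 ⊆ F.1 := (FlatVar.ssubset_top hFt).2
  rw [fullExp, degBelow_add, hC.degBelow_gapExp_of_mem hf hF, degBelow_single, if_neg h, add_zero]

theorem fullExp_apply {C : Finset (FlatVar f)} {F : FlatVar f} (hF : F ∈ C)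
    (hFt : F ≠ FlatVar.top f) : fullExp C F = gap C F := by
  rw [fullExp, Finsupp.add_apply, gapExp_apply, if_pos hF, Finsupp.single_apply, if_neg hFt.symm,
    add_zero]

theorem polyDeg_eq_of_mk_eq (hf : IsLooplessRank f) {p q : MvPolynomial (FlatVar f) ℤ}
    (h : Ideal.Quotient.mk (Ideal.span (DPrels f)) p = Ideal.Quotient.mk _ q) :
    polyDeg f p = polyDeg f q := by
  have := span_DPrels_le_degAnn hf (Ideal.Quotient.eq.1 h) 1
  rwa [mul_one, map_sub, sub_eq_zero] at this

theorem polyDeg_top_pow (hf : IsLooplessRank f) :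
    polyDeg f (X (FlatVar.top f) ^ (f Finset.univ - 1)) = 1 := by
  have := hf.pos Finset.univ Finset.univ_nonempty
  rw [polyDeg_apply, map_pow, toH_X, flatGen_top, X_pow_eq_monomial, hDeg_monomial, hCoeff,
    if_pos]
  refine ⟨?_, fun A hA => ?_⟩
  · rw [degBelow_single, if_pos (Finset.subset_univ _)]
    omega
  · have hA' := hf.pos A hA
    rw [degBelow_single, FlatVar.top_val]
    split_ifs with h
    · rw [Finset.univ_subset_iff.1 h]
      omega
    · omega

theorem FlatChain.polyDeg_fullExp (hf : IsLooplessRank f) {C : Finset (FlatVar f)}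
    (hC : FlatChain C) (htop : FlatVar.top f ∉ C) :
    polyDeg f (monomial (fullExp C) 1) = (-1) ^ C.card := by
  have h := hC.mk_gapExp hf htop
  rw [X_pow_eq_monomial, monomial_mul, one_mul] at h
  have h' : (-1) ^ C.card * Ideal.Quotient.mk (Ideal.span (DPrels f))
      (X (FlatVar.top f) ^ (f Finset.univ - 1)) = Ideal.Quotient.mk _
        (((-1) ^ C.card : ℤ) • X (FlatVar.top f) ^ (f Finset.univ - 1)) := by
    rw [zsmul_eq_mul]
    simp
  rw [fullExp, polyDeg_eq_of_mk_eq hf (h.trans h'), map_smul, polyDeg_top_pow hf, smul_eq_mul,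
    mul_one]

theorem gap_erase_top (C : Finset (FlatVar f)) (F : FlatVar f) :
    gap (C.erase (FlatVar.top f)) F = gap C F := by
  have h : (C.erase (FlatVar.top f)).filter (fun G => G.1 ⊂ F.1) =
      C.filter fun G => G.1 ⊂ F.1 := by
    ext G
    simp only [Finset.mem_filter, Finset.mem_erase]
    exact ⟨fun h => ⟨h.1.2, h.2⟩, fun h => ⟨⟨FlatVar.ne_top_of_ssubset h.2, h.1⟩, h.2⟩⟩
  rw [gap, gap, h]

theorem Standard.le_fullExp {m : FlatVar f →₀ ℕ} (hm : Standard m) :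
    m ≤ fullExp (m.support.erase (FlatVar.top f)) := by
  intro F
  by_cases hF : F ∈ m.support
  swap
  · rw [Finsupp.notMem_support_iff.1 hF]
    exact Nat.zero_le _
  have hlt := hm.2 F hF
  rw [← gap_erase_top] at hlt
  by_cases hFt : F = FlatVar.top f
  · subst hFt
    rw [fullExp, Finsupp.add_apply, Finsupp.single_eq_same]
    have h : ∀ G ∈ m.support.erase (FlatVar.top f), G.1 ⊂ (FlatVar.top f).1 :=
      fun G hG => FlatVar.ssubset_top (Finset.ne_of_mem_erase hG)
    rw [gap, Finset.filter_true_of_mem h, FlatVar.top_val] at hlt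
    omega
  · rw [fullExp_apply (Finset.mem_erase.2 ⟨hFt, hF⟩) hFt]
    exact hlt.le

theorem Standard.degBelow_le_of_mem (hf : IsLooplessRank f) {m n s : FlatVar f →₀ ℕ}
    (hm : Standard m) (hn : m + n = fullExp (m.support.erase (FlatVar.top f)))
    (hs : s.degree = m.degree) (h : polyDeg f (monomial (s + n) 1) ≠ 0) {F : FlatVar f}
    (hF : F ∈ m.support) : degBelow F.1 m ≤ degBelow F.1 s := by
  by_cases hFt : F = FlatVar.top f
  · rw [hFt, FlatVar.top_val, degBelow_univ, degBelow_univ, hs]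
  have hC : FlatChain (m.support.erase (FlatVar.top f)) := hm.1.mono (Finset.erase_subset _ _)
  have hFC := Finset.mem_erase.2 ⟨hFt, hF⟩
  have hnF : (s + n) F ≠ 0 := by
    have h1 := hm.2 F hF
    rw [← gap_erase_top, ← fullExp_apply hFC hFt, ← hn, Finsupp.add_apply] at h1
    rw [Finsupp.add_apply]
    omega
  have h1 := degOutside_le_of_polyDeg_ne_zero hf hFt hnF h
  have h2 := degBelow_add_degOutside F.1 (s + n)
  have h3 := hC.degree_fullExp hf (Finset.notMem_erase _ _)
  have h4 := hC.degBelow_fullExp hf hFC hFt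
  rw [← hn] at h3 h4
  rw [map_add] at h2 h3
  rw [degBelow_add] at h2 h4
  omega

theorem Standard.degBelow_le (hf : IsLooplessRank f) {m n s : FlatVar f →₀ ℕ}
    (hm : Standard m) (hn : m + n = fullExp (m.support.erase (FlatVar.top f)))
    (hs : s.degree = m.degree) (h : polyDeg f (monomial (s + n) 1) ≠ 0) (A : Finset E) :
    degBelow A m ≤ degBelow A s := by
  rcases (m.support.filter fun G => G.1 ⊆ A).eq_empty_or_nonempty with h0 | h0
  · rw [degBelow, Finset.sum_eq_zero]
    · exact Nat.zero_le _
    · intro G hG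
      by_contra hG0
      exact Finset.eq_empty_iff_forall_notMem.1 h0 G (Finset.mem_filter.2
        ⟨Finsupp.mem_support_iff.2 hG0, (Finset.mem_filter.1 hG).2⟩)
  · obtain ⟨F, hF, hmax⟩ := exists_max_of_chain h0 (hm.1.mono (Finset.filter_subset _ _))
    obtain ⟨hFm, hFA⟩ := Finset.mem_filter.1 hF
    have h1 := hm.degBelow_le_of_mem hf hn hs h hFm
    have h2 : degBelow A m ≤ degBelow F.1 m := by
      rw [degBelow, degBelow, Finset.sum_filter, Finset.sum_filter]
      refine Finset.sum_le_sum fun G _ => ?_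
      by_cases hG : G.1 ⊆ A
      · rw [if_pos hG]
        by_cases hGm : G ∈ m.support
        · rw [if_pos (hmax G (Finset.mem_filter.2 ⟨hGm, hG⟩))]
        · rw [Finsupp.notMem_support_iff.1 hGm]
          exact Nat.zero_le _
      · rw [if_neg hG]
        exact Nat.zero_le _
    exact h2.trans (h1.trans (degBelow_mono hFA s))

omit [Nonempty E] in
theorem eq_of_degBelow_eq {m s : FlatVar f →₀ ℕ}
    (h : ∀ G : FlatVar f, degBelow G.1 m = degBelow G.1 s) : m = s := by
  ext F
  induction hn : F.1.card using Nat.strong_induction_on generalizing F with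
  | _ n ih =>
  have hsplit : ∀ W : FlatVar f →₀ ℕ,
      degBelow F.1 W = W F + ∑ G : FlatVar f with G.1 ⊂ F.1, W G := by
    intro W
    rw [degBelow, ← Finset.sum_insert (by simp)]
    congr 1
    ext G
    simp only [Finset.mem_filter, Finset.mem_univ, true_and, Finset.mem_insert]
    refine ⟨fun hG => ?_, ?_⟩
    · by_cases he : G = F
      · exact Or.inl he
      · exact Or.inr (FlatVar.ssubset_of_subset_of_ne hG he)
    · rintro (rfl | hG)
      · exact subset_rfl
      · exact hG.1
  have hF := h F
  rw [hsplit, hsplit, Finset.sum_congr rfl fun G hG => ih _ (hn ▸ Finset.card_lt_card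
    (Finset.mem_filter.1 hG).2) G rfl] at hF
  exact Nat.add_right_cancel hF

/-- A nonzero element of `DP(f)` in degree `k` pairs to a nonzero degree with some monomial. -/
theorem exists_polyDeg_ne_zero (hf : IsLooplessRank f) {k : ℕ}
    {a : MvPolynomial (FlatVar f) ℤ ⧸ Ideal.span (DPrels f)} (ha : a ∈ DPgrade f k) (ha0 : a ≠ 0) :
    ∃ p n, mkLin f p = a ∧ n.degree + k = f Finset.univ - 1 ∧
      polyDeg f (p * monomial n 1) ≠ 0 := by
  obtain ⟨p, hp, rfl⟩ := exists_standard_of_mem_DPgrade hf ha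
  have hp0 : p ≠ 0 := by
    rintro rfl
    exact ha0 (map_zero _)
  rw [standardSub, mem_restrictSupport_iff] at hp
  obtain ⟨m, hm, hmax⟩ := Finset.exists_max_image p.support potential (support_nonempty.2 hp0)
  obtain ⟨hms, hmk⟩ := hp hm
  have hn := add_tsub_cancel_of_le hms.le_fullExp
  have hC : FlatChain (m.support.erase (FlatVar.top f)) := hms.1.mono (Finset.erase_subset _ _)
  have hdeg := hC.degree_fullExp hf (Finset.notMem_erase _ _)
  refine ⟨p, fullExp (m.support.erase (FlatVar.top f)) - m, rfl, ?_, ?_⟩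
  · rw [← hn, map_add] at hdeg
    omega
  have hterm : ∀ s n, polyDeg f (monomial s (coeff s p) * monomial n 1) =
      coeff s p * polyDeg f (monomial (s + n) 1) := by
    intro s n
    rw [monomial_mul, ← smul_eq_mul, ← smul_monomial, map_smul, smul_eq_mul]
  nth_rw 1 [p.as_sum]
  rw [Finset.sum_mul, map_sum, Finset.sum_eq_single_of_mem m hm, hterm, hn,
    hC.polyDeg_fullExp hf (Finset.notMem_erase _ _)]
  · exact mul_ne_zero (mem_support_iff.1 hm) (pow_ne_zero _ (by norm_num))
  · intro s hs hsm
    rw [hterm]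
    by_contra h
    have hle := hms.degBelow_le hf hn ((hp hs).2.trans hmk.symm) (right_ne_zero_of_mul h)
    refine hsm (eq_of_degBelow_eq fun G => ?_)
    have hpot := le_antisymm (hmax s hs) (Finset.sum_le_sum fun G _ => hle G.1)
    exact (((Finset.sum_eq_sum_iff_of_le fun G _ => hle G.1).1 hpot.symm) G
      (Finset.mem_univ _)).symm

omit [Nonempty E] in
theorem mk_mem_DPgrade {p : MvPolynomial (FlatVar f) ℤ} {k : ℕ} (hp : p.IsHomogeneous k) :
    Ideal.Quotient.mk (Ideal.span (DPrels f)) p ∈ DPgrade f k :=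
  Submodule.subset_span ⟨p, hp, rfl⟩

theorem exists_mul_ne_zero (hf : IsLooplessRank f) {k : ℕ}
    {a : MvPolynomial (FlatVar f) ℤ ⧸ Ideal.span (DPrels f)} (ha : a ∈ DPgrade f k) (ha0 : a ≠ 0) :
    ∃ b ∈ DPgrade f (f Finset.univ - 1 - k), a * b ≠ 0 := by
  obtain ⟨p, n, rfl, hn, h⟩ := exists_polyDeg_ne_zero hf ha ha0
  refine ⟨_, mk_mem_DPgrade (isHomogeneous_monomial (1 : ℤ) (Nat.eq_sub_of_add_eq hn)), ?_⟩
  rw [mkLin_apply, ← map_mul]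
  intro h0
  exact h (by rw [polyDeg_eq_of_mk_eq hf (h0.trans (map_zero _).symm), map_zero])

/-- The degree map of `DP(f)`. -/
def dpDeg (hf : IsLooplessRank f) :
    MvPolynomial (FlatVar f) ℤ ⧸ Ideal.span (DPrels f) →ₗ[ℤ] ℤ :=
  (QuotientAddGroup.lift (Submodule.toAddSubgroup (Ideal.span (DPrels f)))
    (polyDeg f).toAddMonoidHom fun p hp => by
      have := span_DPrels_le_degAnn hf hp 1
      rwa [mul_one] at this).toIntLinearMap

theorem dpDeg_mkLin (hf : IsLooplessRank f) (p : MvPolynomial (FlatVar f) ℤ) :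
    dpDeg hf (mkLin f p) = polyDeg f p := rfl

theorem nonempty_topGrade_equiv (hf : IsLooplessRank f) :
    Nonempty (DPgrade f (f Finset.univ - 1) ≃ₗ[ℤ] ℤ) := by
  refine ⟨LinearEquiv.ofBijective (dpDeg hf ∘ₗ (DPgrade f (f Finset.univ - 1)).subtype) ⟨?_, ?_⟩⟩
  · rw [injective_iff_map_eq_zero]
    rintro ⟨a, ha⟩ h
    by_contra h0
    obtain ⟨p, n, rfl, hn, hp⟩ := exists_polyDeg_ne_zero hf ha fun h => h0 (Subtype.ext h)
    obtain rfl : n = 0 := (Finsupp.degree_eq_zero_iff n).1 (by omega)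
    refine hp ?_
    rw [← C_apply, C_1, mul_one]
    exact h
  · intro c
    refine ⟨c • ⟨_, mk_mem_DPgrade (isHomogeneous_X_pow (FlatVar.top f) _)⟩, ?_⟩
    have h : dpDeg hf (mkLin f (X (FlatVar.top f) ^ (f Finset.univ - 1))) = 1 := by
      rw [dpDeg_mkLin, polyDeg_top_pow hf]
    rw [map_smul, LinearMap.comp_apply]
    exact (congrArg (c • ·) h).trans (mul_one c)

end Chow

/-- Poincaré duality: for a loopless polymatroid of rank `r = f(E)`,
`DP^{r−1}(f)` is free of rank one over ℤ, and for `0 ≤ k < r/2` the multiplication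
pairing `DP^k(f) × DP^{r−1−k}(f) → DP^{r−1}(f)` is non-degenerate. -/
theorem dp_poincare_duality {E : Type*} [Fintype E] [Nonempty E]
    (f : Finset E → ℕ)
    (hsub : ∀ A B : Finset E, f (A ∪ B) + f (A ∩ B) ≤ f A + f B)
    (hmono : ∀ A B : Finset E, A ⊆ B → f A ≤ f B)
    (hnorm : f ∅ = 0)
    (hloopless : ∀ A : Finset E, A.Nonempty → 0 < f A) :
    Nonempty ((DPgrade f (f Finset.univ - 1)) ≃ₗ[ℤ] ℤ) ∧
    (∀ k : ℕ, 2 * k < f Finset.univ →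
      (∀ a ∈ DPgrade f k, a ≠ 0 →
        ∃ b ∈ DPgrade f (f Finset.univ - 1 - k), a * b ≠ 0) ∧
      (∀ b ∈ DPgrade f (f Finset.univ - 1 - k), b ≠ 0 →
        ∃ a ∈ DPgrade f k, a * b ≠ 0)) := by
  have hf : IsLooplessRank f := ⟨hsub, hmono, hnorm, hloopless⟩
  refine ⟨nonempty_topGrade_equiv hf, fun k hk => ⟨fun a ha ha0 => exists_mul_ne_zero hf ha ha0,
    fun b hb hb0 => ?_⟩⟩
  obtain ⟨a, ha, hab⟩ := exists_mul_ne_zero hf hb hb0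
  have hk' : f Finset.univ - 1 - (f Finset.univ - 1 - k) = k := by omega
  exact ⟨a, hk' ▸ ha, mul_comm b a ▸ hab⟩

end
end

section
/- Let Ẽ and E be finite sets with π : Ẽ → E surjective. For w ∈ ℝ^Ẽ define Low(w) = {i ∈ Ẽ : w(i) ≤ w(t) for all t ∈ Ẽ with π(t) = π(i)}. For a (possibly empty) chain ∅ ⊊ F₁ ⊊ ⋯ ⊊ F_k ⊊ E of subsets of E and a subset S ⊆ Ẽ containing no fiber of π, let R(𝓕,S) = { Σ_{r=1}^k λ_r·e_{π⁻¹(F_r)} + Σ_{i∈S} μ_i·e_i + t·𝟙 : all λ_r > 0, all μ_i > 0, t ∈ ℝ } ⊆ ℝ^Ẽ (the relative interior of the cone σ_{𝓕,S} of the Bergman fan of the Boolean polymatroid B(π), lifted along the all-ones line). Then for w, v ∈ ℝ^Ẽ the following are equivalent: (a) there exist a chain 𝓕 and a set S as above with w ∈ R(𝓕,S) and v ∈ R(𝓕,S); (b) Low(w) = Low(v) and for all i, j ∈ Low(w), w(i) ≤ w(j) if and only if v(i) ≤ v(j). -/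
/-- The set of elements of minimal weight in their fiber of `π`. -/
def Low {Et E : Type*} (π : Et → E) (w : Et → ℝ) : Set Et :=
  {i | ∀ t, π t = π i → w i ≤ w t}

/-- Membership in the relative interior of the cone `σ_{𝓕,S}` of the Bergman fan of the
Boolean polymatroid `B(π)`, lifted along the all-ones line: `w` is a positive combination
of the vectors `e_{π⁻¹(F_r)}`, positive multiples of `e_i` for `i ∈ S`, and a real
multiple of the all-ones vector. -/
def InRelInt {Et E : Type*} [Fintype Et] [DecidableEq Et] [DecidableEq E]
    (π : Et → E) {k : ℕ} (F : Fin k → Finset E) (S : Finset Et) (w : Et → ℝ) : Prop :=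
  ∃ (lam : Fin k → ℝ) (mu : Et → ℝ) (t : ℝ),
    (∀ r, 0 < lam r) ∧ (∀ i ∈ S, 0 < mu i) ∧
    w = fun x => (∑ r, lam r * (if π x ∈ F r then 1 else 0)) +
      (∑ i ∈ S, mu i * (if x = i then 1 else 0)) + t

theorem chain_sum_le_iff {E : Type*} [DecidableEq E] {k : ℕ} {F : Fin k → Finset E}
    (hF : ∀ r r' : Fin k, r < r' → F r ⊂ F r') {lam : Fin k → ℝ} (hlam : ∀ r, 0 < lam r)
    (a b : E) :
    (∑ r, lam r * (if a ∈ F r then 1 else 0) ≤ ∑ r, lam r * (if b ∈ F r then 1 else 0)) ↔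
      ∀ r, a ∈ F r → b ∈ F r := by
  constructor
  · intro h r ha
    by_contra hb
    refine absurd h (not_le.2 (Finset.sum_lt_sum (fun r' _ => ?_) ⟨r, Finset.mem_univ r, ?_⟩))
    · have hlam' := hlam r'
      by_cases hb' : b ∈ F r'
      · have ha' : a ∈ F r' := by
          rcases lt_trichotomy r r' with h1 | h1 | h1
          · exact (hF _ _ h1).1 ha
          · exact h1 ▸ ha
          · exact absurd ((hF _ _ h1).1 hb') hb
        simp [ha', hb']
      · rw [if_neg hb']
        split_ifs <;> linarith
    · simp [ha, hb, hlam r]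
  · intro h
    refine Finset.sum_le_sum fun r _ => mul_le_mul_of_nonneg_left ?_ (hlam r).le
    by_cases ha : a ∈ F r
    · simp [ha, h r ha]
    · rw [if_neg ha]
      split_ifs <;> norm_num

section InRelInt

variable {Et E : Type*} [Fintype Et] [DecidableEq Et] [DecidableEq E]
  {π : Et → E} {k : ℕ} {F : Fin k → Finset E} {S : Finset Et} {w : Et → ℝ}

theorem inRelInt_iff :
    InRelInt π F S w ↔ ∃ (lam : Fin k → ℝ) (mu : Et → ℝ) (t : ℝ),
      (∀ r, 0 < lam r) ∧ (∀ i ∈ S, 0 < mu i) ∧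
      ∀ x, w x = (∑ r, lam r * (if π x ∈ F r then 1 else 0)) + (if x ∈ S then mu x else 0) + t := by
  simp [InRelInt, funext_iff]

theorem InRelInt.mem_low_iff (h : InRelInt π F S w) (hS : ∀ i : E, ∃ x : Et, π x = i ∧ x ∉ S)
    (x : Et) : x ∈ Low π w ↔ x ∉ S := by
  obtain ⟨lam, mu, t, -, hmu, hw⟩ := inRelInt_iff.1 h
  constructor
  · intro hx hxS
    obtain ⟨y, hy, hyS⟩ := hS (π x)
    have hle := hx y hy
    rw [hw, hw, if_pos hxS, if_neg hyS, hy] at hle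
    linarith [hmu x hxS]
  · intro hxS y hy
    rw [hw x, hw y, if_neg hxS, hy]
    split_ifs with hyS
    · linarith [hmu y hyS]
    · exact le_rfl

theorem InRelInt.le_iff (h : InRelInt π F S w) (hF : ∀ r r' : Fin k, r < r' → F r ⊂ F r')
    {i j : Et} (hi : i ∉ S) (hj : j ∉ S) :
    w i ≤ w j ↔ ∀ r, π i ∈ F r → π j ∈ F r := by
  obtain ⟨lam, mu, t, hlam, -, hw⟩ := inRelInt_iff.1 h
  rw [← chain_sum_le_iff hF hlam, hw, hw, if_neg hi, if_neg hj]
  simp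

end InRelInt

theorem exists_surjective_rank {E : Type*} [Fintype E] [Nonempty E] (h : E → ℝ) :
    ∃ (k : ℕ) (ρ : E → Fin (k + 1)), Function.Surjective ρ ∧ ∀ a b, h a ≤ h b ↔ ρ b ≤ ρ a := by
  classical
  let s := Finset.univ.image (-h)
  have hs : s.Nonempty := Finset.univ_nonempty.image _
  have hcard : s.card = (s.card - 1) + 1 := (Nat.succ_pred_eq_of_pos hs.card_pos).symm
  have hmem (e : E) : (-h) e ∈ s := Finset.mem_image_of_mem _ (Finset.mem_univ e)
  refine ⟨s.card - 1, fun e => (s.orderIsoOfFin hcard).symm ⟨(-h) e, hmem e⟩, ?_, ?_⟩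
  · refine (s.orderIsoOfFin hcard).symm.surjective.comp ?_
    rintro ⟨y, hy⟩
    obtain ⟨e, -, rfl⟩ := Finset.mem_image.1 hy
    exact ⟨e, rfl⟩
  · intro a b
    simp

theorem sum_castSucc_sub_succ {k : ℕ} (g : Fin (k + 1) → ℝ) (j : Fin (k + 1)) :
    (∑ r : Fin k, (g r.castSucc - g r.succ) * (if j ≤ r.castSucc then 1 else 0)) +
      g (Fin.last k) = g j := by
  induction j using Fin.reverseInduction with
  | last => simp [Fin.last_le_iff, Fin.castSucc_ne_last]
  | cast i ih =>
    have hsplit (r : Fin k) : (if i.castSucc ≤ r.castSucc then (1 : ℝ) else 0) =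
        (if i.succ ≤ r.castSucc then 1 else 0) + (if i = r then 1 else 0) := by
      simp only [Fin.le_def, Fin.ext_iff, Fin.val_castSucc, Fin.val_succ]
      split_ifs <;> first | omega | norm_num
    simp only [hsplit, mul_add, Finset.sum_add_distrib]
    rw [add_right_comm, ih]
    simp

theorem inRelInt_of_rank {Et E : Type*} [Fintype Et] [Fintype E] [DecidableEq Et]
    [DecidableEq E] {π : Et → E} {w : Et → ℝ} {s : E → Et} (hs : ∀ e, π (s e) = e)
    (hlow : ∀ e, s e ∈ Low π w) {k : ℕ} {ρ : E → Fin (k + 1)} (hρ : Function.Surjective ρ)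
    (hle : ∀ a b, w (s a) ≤ w (s b) ↔ ρ b ≤ ρ a) {S : Finset Et}
    (hS : ∀ x, x ∈ S ↔ x ∉ Low π w) :
    InRelInt π (fun r : Fin k => Finset.univ.filter fun e => ρ e ≤ r.castSucc) S w := by
  let g : Fin (k + 1) → ℝ := fun j => w (s (Function.surjInv hρ j))
  have hg (e : E) : g (ρ e) = w (s e) :=
    le_antisymm ((hle _ _).2 (Function.surjInv_eq hρ _).ge)
      ((hle _ _).2 (Function.surjInv_eq hρ _).le)
  refine inRelInt_iff.2 ⟨fun r => g r.castSucc - g r.succ, fun x => w x - w (s (π x)),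
    g (Fin.last k), fun r => ?_, fun x hx => ?_, fun x => ?_⟩
  · rw [sub_pos, ← not_le, hle, Function.surjInv_eq hρ, Function.surjInv_eq hρ, not_le]
    exact Fin.castSucc_lt_succ
  · by_contra hx'
    refine (hS x).1 hx fun t ht => ?_
    have := hlow (π x) t (by rw [hs, ht])
    linarith
  · have hsum := sum_castSucc_sub_succ g (ρ (π x))
    rw [hg] at hsum
    simp only [Finset.mem_filter, Finset.mem_univ, true_and]
    rw [add_right_comm, hsum]
    split_ifs with hx
    · ring
    · have hx' : x ∈ Low π w := by_contra fun h => hx ((hS x).2 h)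
      rw [add_zero]
      exact le_antisymm (hx' _ (hs _)) (hlow _ _ (hs _).symm)

theorem exists_mem_low {Et E : Type*} [Finite Et] {π : Et → E} (hπ : Function.Surjective π)
    (w : Et → ℝ) (e : E) : ∃ x, π x = e ∧ x ∈ Low π w := by
  obtain ⟨x, hx, hmin⟩ := Set.exists_min_image {x | π x = e} w (Set.toFinite _) (hπ e)
  exact ⟨x, hx, fun t ht => hmin t (ht.trans hx)⟩

/-- two weight vectors lie in the relative interior of a common cone of
the Bergman fan of the Boolean polymatroid `B(π)` iff they define the same poset
`Low(·)` of fiberwise-minimal elements. -/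
theorem bergman_cone_iff_lowest_poset {Et E : Type*} [Fintype Et] [Fintype E]
    [DecidableEq Et] [DecidableEq E]
    (π : Et → E) (hπ : Function.Surjective π) (w v : Et → ℝ) :
    (∃ (k : ℕ) (F : Fin k → Finset E) (S : Finset Et),
        (∀ r, (F r).Nonempty) ∧ (∀ r, F r ≠ Finset.univ) ∧
        (∀ r r' : Fin k, r < r' → F r ⊂ F r') ∧
        (∀ i : E, ∃ x : Et, π x = i ∧ x ∉ S) ∧
        InRelInt π F S w ∧ InRelInt π F S v)
    ↔ (Low π w = Low π v ∧
        ∀ i ∈ Low π w, ∀ j ∈ Low π w, (w i ≤ w j ↔ v i ≤ v j)) := by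
  constructor
  · rintro ⟨k, F, S, -, -, hF, hS, hw, hv⟩
    refine ⟨Set.ext fun x => (hw.mem_low_iff hS x).trans (hv.mem_low_iff hS x).symm, ?_⟩
    intro i hi j hj
    rw [hw.mem_low_iff hS] at hi hj
    rw [hw.le_iff hF hi hj, hv.le_iff hF hi hj]
  · rintro ⟨hlow, hle⟩
    classical
    choose s hs hsw using exists_mem_low hπ w
    let S : Finset Et := Finset.univ.filter fun x => x ∉ Low π w
    have hS (x : Et) : x ∈ S ↔ x ∉ Low π w := by simp [S]
    have hfib (e : E) : ∃ x, π x = e ∧ x ∉ S := ⟨s e, hs e, by simpa [hS] using hsw e⟩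
    rcases isEmpty_or_nonempty E with hE | hE
    · have : IsEmpty Et := π.isEmpty
      refine ⟨0, Fin.elim0, S, fun r => r.elim0, fun r => r.elim0, fun r => r.elim0, hfib, ?_, ?_⟩ <;>
        exact inRelInt_iff.2 ⟨fun _ => 1, fun _ => 1, 0, by simp, by simp, isEmptyElim⟩
    · obtain ⟨k, ρ, hρ, hρle⟩ := exists_surjective_rank fun e => w (s e)
      refine ⟨k, fun r => Finset.univ.filter fun e => ρ e ≤ r.castSucc, S, fun r => ?_,
        fun r h => ?_, fun r r' hr => ?_, hfib, inRelInt_of_rank hs hsw hρ hρle hS,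
        inRelInt_of_rank hs (fun e => hlow ▸ hsw e) hρ
          (fun a b => (hle _ (hsw a) _ (hsw b)).symm.trans (hρle a b)) (hlow ▸ hS)⟩
      · obtain ⟨e, he⟩ := hρ 0
        exact ⟨e, by simp [he]⟩
      · obtain ⟨e, he⟩ := hρ (Fin.last k)
        have := h.ge (Finset.mem_univ e)
        simp [he, Fin.last_le_iff, Fin.castSucc_ne_last] at this
      · refine Finset.ssubset_iff_subset_ne.2 ⟨fun e he => ?_, fun h => ?_⟩
        · simp only [Finset.mem_filter, Finset.mem_univ, true_and] at he ⊢
          exact he.trans (Fin.castSucc_le_castSucc_iff.2 hr.le)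
        · obtain ⟨e, he⟩ := hρ r'.castSucc
          have := (Finset.ext_iff.1 h e).2 (by simp [he])
          simp only [Finset.mem_filter, Finset.mem_univ, true_and, he,
            Fin.castSucc_le_castSucc_iff] at this
          exact absurd this (not_le.2 hr)
end
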